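/- arXiv:2105.05174 — 2 statements merged into one kernel-verified Lean document; each statement's English description precedes it below -/
import Mathlib

section
/- Fix d ≥ 2 and set D = ζ(d)^{−1}·Vol(B̄(0,1))/2, where ζ is the Riemann zeta function and Vol(B̄(0,1)) is the Lebesgue volume of the closed Euclidean unit ball of ℝ^d. Then there exist constants C > 0 and a₀ > 0 such that for every a ≥ a₀, |μ_d({L ∈ 𝒮_d : ‖L‖^{−d} > a}) − D·a^{−1}| ≤ C·a^{−2}. -/
noncomputable section

open MeasureTheory

/-- `SL_d(ℝ)`. -/
abbrev SLR (d : ℕ) := Matrix.SpecialLinearGroup (Fin d) ℝ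

/-- `SL_d(ℤ)` viewed as a subgroup of `SL_d(ℝ)` (the range of the coefficientwise
integer-cast homomorphism `SL_d(ℤ) →* SL_d(ℝ)`). -/
def SLZ (d : ℕ) : Subgroup (SLR d) :=
  (Matrix.SpecialLinearGroup.map (n := Fin d) (Int.castRingHom ℝ)).range

instance (d : ℕ) : MeasurableSpace (Matrix (Fin d) (Fin d) ℝ) :=
  inferInstanceAs (MeasurableSpace (Fin d → Fin d → ℝ))

instance (d : ℕ) : MeasurableSpace (SLR d) :=
  inferInstanceAs (MeasurableSpace {A : Matrix (Fin d) (Fin d) ℝ // A.det = 1})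

/-- The space of unimodular lattices `𝒮_d = SL_d(ℝ)/SL_d(ℤ)`; the coset of
`g ∈ SL_d(ℝ)` corresponds to the lattice `g·ℤ^d`. -/
abbrev LatticeSpace (d : ℕ) := SLR d ⧸ SLZ d

/-- The vector `g·v ∈ ℝ^d` for `g ∈ SL_d(ℝ)` and `v ∈ ℤ^d`: a point of the
lattice `g·ℤ^d`. -/
def latVec {d : ℕ} (g : SLR d) (v : Fin d → ℤ) : EuclideanSpace ℝ (Fin d) :=
  (WithLp.equiv 2 (Fin d → ℝ)).symm (g.1.mulVec fun i => (v i : ℝ))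

/-- The minimal norm `‖L‖ = inf {‖l‖ : l ∈ L ∖ {0}}` of the lattice `L = g·ℤ^d`. -/
def gMin {d : ℕ} (g : SLR d) : ℝ :=
  sInf {r : ℝ | ∃ v : Fin d → ℤ, latVec g v ≠ 0 ∧ ‖latVec g v‖ = r}

open Matrix in
/-- `γ` fixes the first `k` standard basis vectors. -/
def FixesFirst {d : ℕ} (k : ℕ) (γ : Matrix.SpecialLinearGroup (Fin d) ℤ) : Prop :=
  ∀ i : Fin d, (i : ℕ) < k → ∀ l, γ.1 l i = (1 : Matrix (Fin d) (Fin d) ℤ) l i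

section Integral

open Matrix

variable {d : ℕ}

theorem FixesFirst.one (k : ℕ) : FixesFirst k (1 : Matrix.SpecialLinearGroup (Fin d) ℤ) :=
  fun _ _ _ => rfl

theorem FixesFirst.mono {k k' : ℕ} (h : k ≤ k') {γ : Matrix.SpecialLinearGroup (Fin d) ℤ}
    (hγ : FixesFirst k' γ) : FixesFirst k γ :=
  fun i hi l => hγ i (hi.trans_le h) l

theorem FixesFirst.mul {k : ℕ} {γ γ' : Matrix.SpecialLinearGroup (Fin d) ℤ}
    (hγ : FixesFirst k γ) (hγ' : FixesFirst k γ') : FixesFirst k (γ * γ') := by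
  intro i hi l
  rw [Matrix.SpecialLinearGroup.coe_mul, Matrix.mul_apply]
  simp_rw [hγ' i hi]
  rw [← Matrix.mul_apply, mul_one, hγ i hi]

theorem FixesFirst.transvection {k : ℕ} {i l : Fin d} (hil : i ≠ l) (hl : k ≤ (l : ℕ)) (c : ℤ) :
    FixesFirst k (Matrix.SpecialLinearGroup.transvection hil c) := by
  intro m hm n
  rw [Matrix.SpecialLinearGroup.transvection_coe, Matrix.add_apply, Matrix.single_apply_of_col_ne]
  · simp
  · rintro rfl
    omega

theorem FixesFirst.mulVec_eq {k : ℕ} {γ : Matrix.SpecialLinearGroup (Fin d) ℤ} (hγ : FixesFirst k γ)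
    {v : Fin d → ℤ} (hv : ∀ i : Fin d, k ≤ (i : ℕ) → v i = 0) : γ.1 *ᵥ v = v := by
  ext l
  conv_rhs => rw [← Matrix.one_mulVec v]
  simp only [Matrix.mulVec, dotProduct]
  refine Finset.sum_congr rfl fun i _ => ?_
  rcases lt_or_ge (i : ℕ) k with h | h
  · rw [hγ i h]
  · rw [hv i h, mul_zero, mul_zero]

theorem transvection_mulVec {i l : Fin d} (hil : i ≠ l) (c : ℤ) (w : Fin d → ℤ) :
    (Matrix.SpecialLinearGroup.transvection hil c).1 *ᵥ w =
      Function.update w i (w i + c * w l) := by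
  rw [Matrix.SpecialLinearGroup.transvection_coe, add_mulVec, single_mulVec_eq, one_mulVec]
  ext m
  by_cases h : m = i
  · subst h; simp
  · simp [h]

/-- Euclid's algorithm: an integer vector can be brought, by an element of `SL_d(ℤ)` fixing the
first `j` basis vectors, to a vector vanishing after position `j`. -/
theorem exists_fixesFirst_mulVec (j : Fin d) (w : Fin d → ℤ) :
    ∃ γ : Matrix.SpecialLinearGroup (Fin d) ℤ, FixesFirst j γ ∧
      ∃ y : Fin d → ℤ, w = γ.1 *ᵥ y ∧ ∀ i, j < i → y i = 0 := by
  induction hN : (w j).natAbs + 2 * ∑ i with j < i, (w i).natAbs using Nat.strong_induction_on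
    generalizing w with
  | _ N ih =>
  have step : ∀ {i l : Fin d} (hil : i ≠ l) (c : ℤ), j ≤ l → ∀ w' : Fin d → ℤ,
      w' = Function.update w i (w i + c * w l) →
      (∃ γ : Matrix.SpecialLinearGroup (Fin d) ℤ, FixesFirst j γ ∧
        ∃ y : Fin d → ℤ, w' = γ.1 *ᵥ y ∧ ∀ i, j < i → y i = 0) →
      ∃ γ : Matrix.SpecialLinearGroup (Fin d) ℤ, FixesFirst j γ ∧
        ∃ y : Fin d → ℤ, w = γ.1 *ᵥ y ∧ ∀ i, j < i → y i = 0 := by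
    rintro i l hil c hl w' hw' ⟨γ, hγ, y, hy, hy0⟩
    refine ⟨Matrix.SpecialLinearGroup.transvection hil (-c) * γ,
      (FixesFirst.transvection hil hl _).mul hγ, y, ?_, hy0⟩
    rw [Matrix.SpecialLinearGroup.coe_mul, ← mulVec_mulVec, ← hy, hw', transvection_mulVec]
    ext m
    by_cases h : m = i
    · subst h; simp [hil.symm]
    · simp [h]
  by_cases h0 : ∀ i, j < i → w i = 0
  · exact ⟨1, FixesFirst.one _, w, by simp, h0⟩
  push Not at h0
  obtain ⟨i, hji, hi⟩ := h0
  have hsum : ∀ v : Fin d → ℤ, (∀ m, m ≠ i → m ≠ j → v m = w m) →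
      (v i).natAbs + ∑ m with j < m, (w m).natAbs =
      (w i).natAbs + ∑ m with j < m, (v m).natAbs := by
    intro v hv
    have hmem : i ∈ Finset.univ.filter (fun m => j < m) := by simp [hji]
    rw [← Finset.add_sum_erase _ _ hmem, ← Finset.add_sum_erase _ (fun m => (v m).natAbs) hmem]
    rw [Finset.sum_congr rfl (g := fun m => (w m).natAbs)
      (s₁ := (Finset.univ.filter (fun m => j < m)).erase i) (f := fun m => (v m).natAbs)]
    · omega
    · intro m hm
      simp only [Finset.mem_erase, Finset.mem_filter, Finset.mem_univ, true_and] at hm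
      rw [hv m hm.1 hm.2.ne']
  by_cases hj : w j = 0
  · refine step (i := j) (l := i) hji.ne 1 hji.le _ rfl ?_
    have hv := hsum (Function.update (Function.update w j (w i)) i 0) (by
      intro m h1 h2; simp [h1, h2])
    obtain ⟨γ, hγ, y, hy, hy0⟩ := ih _ (by
      subst hN
      simp [hji.ne, hj] at hv ⊢
      omega) (Function.update (Function.update w j (w i)) i 0) rfl
    refine ⟨Matrix.SpecialLinearGroup.transvection hji.ne' 1 * γ,
      (FixesFirst.transvection hji.ne' le_rfl _).mul hγ, y, ?_, hy0⟩
    rw [Matrix.SpecialLinearGroup.coe_mul, ← mulVec_mulVec, ← hy, transvection_mulVec]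
    ext m
    by_cases h : m = i
    · subst h; simp [hji.ne, hji.ne']
    · by_cases h' : m = j
      · subst h'; simp [h, hj]
      · simp [h, h']
  · rcases le_total (w j).natAbs (w i).natAbs with hle | hle
    · obtain ⟨c, hc⟩ : ∃ c : ℤ, (w i + c * w j).natAbs < (w i).natAbs := by
        rcases lt_or_gt_of_ne hi with h1 | h1 <;> rcases lt_or_gt_of_ne hj with h2 | h2
        · exact ⟨-1, by omega⟩
        · exact ⟨1, by omega⟩
        · exact ⟨1, by omega⟩
        · exact ⟨-1, by omega⟩
      refine step (i := i) (l := j) hji.ne' c le_rfl _ rfl (ih _ ?_ _ rfl)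
      have hv := hsum (Function.update w i (w i + c * w j)) (by intro m h1 h2; simp [h1])
      subst hN
      simp [hji.ne] at hv ⊢
      omega
    · obtain ⟨c, hc⟩ : ∃ c : ℤ, (w j + c * w i).natAbs < (w j).natAbs := by
        rcases lt_or_gt_of_ne hi with h1 | h1 <;> rcases lt_or_gt_of_ne hj with h2 | h2
        · exact ⟨-1, by omega⟩
        · exact ⟨1, by omega⟩
        · exact ⟨1, by omega⟩
        · exact ⟨-1, by omega⟩
      refine step (i := j) (l := i) hji.ne c hji.le _ rfl (ih _ ?_ _ rfl)
      have hv := hsum (Function.update w j (w j + c * w i)) (by intro m h1 h2; simp [h2])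
      subst hN
      simp [hji.ne'] at hv ⊢
      omega

/-- The unipotent matrix adding the combination `s` of the first columns to column `j`. -/
def addToColumn (j : Fin d) (s : Fin d → ℤ) (hs : s j = 0) : Matrix.SpecialLinearGroup (Fin d) ℤ :=
  ⟨1 + replicateCol Unit s * replicateRow Unit (Pi.single j (1 : ℤ)), by
    rw [det_one_add_replicateCol_mul_replicateRow]; simp [hs]⟩

theorem addToColumn_apply (j : Fin d) (s : Fin d → ℤ) (hs : s j = 0) (l i : Fin d) :
    (addToColumn j s hs).1 l i = (1 : Matrix (Fin d) (Fin d) ℤ) l i + if i = j then s l else 0 := by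
  by_cases h : i = j
  · subst h; simp [addToColumn, Matrix.mul_apply]
  · simp [addToColumn, Matrix.mul_apply, h]

theorem exists_fixesFirst_column (j : Fin d) (w : Fin d → ℤ) (hw : ∃ i, j ≤ i ∧ w i ≠ 0) :
    ∃ n : ℤ, n ≠ 0 ∧ ∀ τ : Fin d → ℝ, ∃ γ : Matrix.SpecialLinearGroup (Fin d) ℤ, FixesFirst j γ ∧
      ∃ θ : Fin d → ℝ, (∀ l, j ≤ l → θ l = 0) ∧ (∀ l, l < j → |τ l + θ l| ≤ 1 / 2) ∧
        ∀ l, ((γ.1 l j : ℤ) : ℝ) = w l / n + θ l := by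
  obtain ⟨γ, hγ, y, hy, hy0⟩ := exists_fixesFirst_mulVec j w
  have hyj : y j ≠ 0 := by
    intro h0
    obtain ⟨i, hi, hwi⟩ := hw
    have hz : ∀ i : Fin d, (j : ℕ) ≤ (i : ℕ) → y i = 0 := by
      intro i hi
      rcases eq_or_lt_of_le (show j ≤ i from hi) with h | h
      · rw [← h, h0]
      · exact hy0 i h
    rw [hγ.mulVec_eq hz] at hy
    exact hwi (hy ▸ hz i hi)
  have hw' : ∀ l, w l = (if l < j then y l else 0) + y j * γ.1 l j := by
    intro l
    have hsplit : y = (fun m => if m < j then y m else 0) + Pi.single j (y j) := by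
      ext m
      rcases lt_trichotomy m j with h | h | h
      · simp [h, h.ne]
      · subst h; simp
      · simp [h.not_gt, h.ne', hy0 m h]
    have hfix : γ.1 *ᵥ (fun m => if m < j then y m else 0) = fun m => if m < j then y m else 0 :=
      hγ.mulVec_eq fun i hi => by simp [show ¬ i < j from not_lt.2 hi]
    conv_lhs => rw [hy, hsplit, mulVec_add, hfix]
    simp [mul_comm]
  refine ⟨y j, hyj, fun τ => ?_⟩
  set s : Fin d → ℤ := fun l => if l < j then round ((y l : ℝ) / y j - τ l) else 0 with hs
  have hsj : s j = 0 := by simp [hs]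
  have hyj' : (y j : ℝ) ≠ 0 := by exact_mod_cast hyj
  refine ⟨γ * addToColumn j s hsj, hγ.mul ?_, fun l => s l - (if l < j then (y l : ℝ) else 0) / y j,
    ?_, ?_, ?_⟩
  · intro i hi l
    rw [addToColumn_apply, if_neg (by rintro rfl; exact lt_irrefl _ hi), add_zero]
  · intro l hl
    simp [hs, hl.not_gt]
  · intro l hl
    simp only [hs, if_pos hl]
    have := abs_sub_round ((y l : ℝ) / y j - τ l)
    rw [abs_sub_comm] at this
    refine le_of_eq_of_le (congrArg abs ?_) this
    ring
  · intro l
    have h1 : (γ * addToColumn j s hsj).1 l j = γ.1 l j + s l := by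
      have hfix : γ.1 *ᵥ s = s := hγ.mulVec_eq fun i hi => by
        simp [hs, show ¬ i < j from not_lt.2 hi]
      rw [Matrix.SpecialLinearGroup.coe_mul, Matrix.mul_apply]
      simp_rw [addToColumn_apply, if_true, mul_add, Finset.sum_add_distrib]
      rw [← Matrix.mul_apply, mul_one]
      congr 1
      exact congrFun hfix l
    rw [h1]
    have := hw' l
    push_cast
    rw [this]
    split_ifs <;> push_cast <;> field_simp <;> ring

end Integral

section Reduction

open Matrix

variable {d : ℕ}

/-- Minkowski's theorem on linear forms. -/
theorem exists_int_abs_mulVec_le (A : Matrix (Fin d) (Fin d) ℝ) (hA : A.det ≠ 0) (c : Fin d → ℝ)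
    (hc : ∀ l, 0 ≤ c l) (h : |A.det| < ∏ l, c l) :
    ∃ v : Fin d → ℤ, v ≠ 0 ∧ ∀ l, |(A *ᵥ fun i => (v i : ℝ)) l| ≤ c l := by
  classical
  set b := Pi.basisFun ℝ (Fin d)
  set s : Set (Fin d → ℝ) := (Matrix.toLin' A) ⁻¹' (Set.Icc (-c) c) with hs
  have hdet : LinearMap.det (Matrix.toLin' A) ≠ 0 := by rwa [LinearMap.det_toLin']
  have hvol : volume s = ENNReal.ofReal (|A.det|⁻¹ * ∏ l, (2 * c l)) := by
    rw [hs, Measure.addHaar_preimage_linearMap _ hdet, Real.volume_Icc_pi, LinearMap.det_toLin',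
      ← ENNReal.ofReal_prod_of_nonneg, ← ENNReal.ofReal_mul (abs_nonneg _), abs_inv]
    · congr 2
      refine Finset.prod_congr rfl fun l _ => ?_
      simp; ring
    · intro l _
      have := hc l
      simp; linarith
  have hfund := ZSpan.isAddFundamentalDomain b (volume : Measure (Fin d → ℝ))
  have : Countable (Submodule.span ℤ (Set.range b)).toAddSubgroup :=
    inferInstanceAs (Countable (Submodule.span ℤ (Set.range b)))
  have hsymm : ∀ x ∈ s, -x ∈ s := by
    intro x hx
    simp only [hs, Set.mem_preimage, map_neg] at hx ⊢
    exact ⟨neg_le_neg hx.2, neg_le.1 hx.1⟩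
  have hconv : Convex ℝ s := (convex_Icc _ _).linear_preimage _
  have hlt : volume (ZSpan.fundamentalDomain b) * 2 ^ Module.finrank ℝ (Fin d → ℝ) < volume s := by
    rw [hvol, ZSpan.fundamentalDomain_pi_basisFun, volume_pi_pi]
    have h0 : 0 < |A.det| := abs_pos.2 hA
    simp only [Real.volume_Ico, sub_zero, ENNReal.ofReal_one, Finset.prod_const_one, one_mul,
      Module.finrank_fin_fun]
    rw [show (2 : ENNReal) ^ d = ENNReal.ofReal (2 ^ d) by
      rw [ENNReal.ofReal_pow (by norm_num)]; simp]
    refine (ENNReal.ofReal_lt_ofReal_iff_of_nonneg (by positivity)).2 ?_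
    rw [Finset.prod_mul_distrib]
    simp only [Finset.prod_const, Finset.card_univ, Fintype.card_fin]
    rw [inv_mul_eq_div, lt_div_iff₀ h0]
    exact mul_lt_mul_of_pos_left h (by positivity)
  obtain ⟨⟨x, hxL⟩, hx0, hxs⟩ := exists_ne_zero_mem_lattice_of_measure_mul_two_pow_lt_measure
    (L := (Submodule.span ℤ (Set.range b)).toAddSubgroup) hfund hsymm hconv hlt
  have hx : ∀ i, ∃ n : ℤ, (n : ℝ) = x i := by
    intro i
    have := (b.mem_span_iff_repr_mem ℤ x).1 hxL i
    simpa [b] using this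
  choose v hv using hx
  refine ⟨v, ?_, ?_⟩
  · rintro rfl
    apply hx0
    ext i
    simpa using (hv i).symm
  · have hxv : (fun i => (v i : ℝ)) = x := funext hv
    rw [hxv]
    intro l
    exact abs_le.2 ⟨hxs.1 l, hxs.2 l⟩

/-- The columns `b l`, `l < k`, completed by standard basis vectors. -/
def complMatrix (k : ℕ) (σ : Fin d → Fin d) (b : Fin d → Fin d → ℝ) : Matrix (Fin d) (Fin d) ℝ :=
  (Matrix.of fun l => if (l : ℕ) < k then b l else Pi.single (σ l) 1)ᵀ

theorem complMatrix_congr {k : ℕ} {σ : Fin d → Fin d} {b b' : Fin d → Fin d → ℝ}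
    (h : ∀ i : Fin d, (i : ℕ) < k → b i = b' i) : complMatrix k σ b = complMatrix k σ b' := by
  ext i l
  simp only [complMatrix, Matrix.transpose_apply, Matrix.of_apply]
  split_ifs with hl
  · rw [h l hl]
  · rfl

theorem exists_complMatrix_det_ne_zero (b : Fin d → Fin d → ℝ) (hb : (Matrix.of b)ᵀ.det ≠ 0)
    (k : ℕ) : ∃ σ : Fin d → Fin d, (complMatrix k σ b).det ≠ 0 := by
  have hbig : ∀ k, d ≤ k → complMatrix k id b = (Matrix.of b)ᵀ := by
    intro k hk
    ext i l
    simp [complMatrix, l.isLt.trans_le hk]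
  rcases le_total d k with hk | hk
  · exact ⟨id, by rwa [hbig k hk]⟩
  · induction hk using Nat.decreasingInduction with
    | self => exact ⟨id, by rwa [hbig d le_rfl]⟩
    | of_succ k hk ih =>
      obtain ⟨σ, hσ⟩ := ih
      by_contra! hcon
      set K : Fin d := ⟨k, hk⟩
      apply hσ
      have hup : complMatrix (k + 1) σ b = (complMatrix (k + 1) σ b).updateCol K (b K) := by
        ext i l
        by_cases hl : l = K
        · subst hl; simp [complMatrix, K]
        · simp [Matrix.updateCol_ne hl]
      have hz : ∀ i, (complMatrix (k + 1) σ b).adjugate K i = 0 := by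
        intro i
        have h1 := hcon (Function.update σ K i)
        have h2 := congrFun (Matrix.cramer_eq_adjugate_mulVec (complMatrix (k + 1) σ b)
          (Pi.single i 1)) K
        rw [Matrix.cramer_apply] at h2
        simp only [Matrix.mulVec_single_one, Matrix.col_apply] at h2
        rw [← h2, ← h1]
        congr 1
        ext m l
        by_cases hl : l = K
        · subst hl; simp [complMatrix, K]
        · have : (l : ℕ) ≠ k := fun h => hl (Fin.ext h)
          have h3 : (l : ℕ) ≤ k ↔ (l : ℕ) < k := by omega
          simp [Matrix.updateCol_ne hl, complMatrix, h3, Function.update_of_ne hl]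
      rw [hup, ← Matrix.cramer_apply, Matrix.cramer_eq_adjugate_mulVec]
      simp [Matrix.mulVec, dotProduct, hz]

/-- The bounds on the coordinates of a reduced column. -/
def redBound (j : Fin d) (D : ℝ) (l : Fin d) : ℝ :=
  if l < j then 1 / 2 else if l = j then 2 ^ d / D else 2 ^ d

theorem redBound_nonneg (j : Fin d) {D : ℝ} (hD : 0 ≤ D) (l : Fin d) : 0 ≤ redBound j D l := by
  unfold redBound
  split_ifs <;> positivity

/-- The set of possible `j`-th columns of a reduced basis with given previous columns. -/
def redSet (j : Fin d) (b : Fin d → Fin d → ℝ) : Set (Fin d → ℝ) :=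
  {x | ∃ σ : Fin d → Fin d, (complMatrix j σ b).det ≠ 0 ∧
    ∀ l, |((complMatrix j σ b)⁻¹ *ᵥ x) l| ≤ redBound j |(complMatrix j σ b).det| l}

theorem redSet_congr {j : Fin d} {b b' : Fin d → Fin d → ℝ} (h : ∀ i < j, b i = b' i) :
    redSet j b = redSet j b' := by
  ext x
  simp only [redSet, complMatrix_congr (k := j) (b := b) (b' := b') fun i hi => h i hi]

theorem mem_redSet_iff {j : Fin d} {b : Fin d → Fin d → ℝ} {x : Fin d → ℝ} :
    x ∈ redSet j b ↔ ∃ σ : Fin d → Fin d, (complMatrix j σ b).det ≠ 0 ∧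
      ∃ t : Fin d → ℝ, x = complMatrix j σ b *ᵥ t ∧
        ∀ l, |t l| ≤ redBound j |(complMatrix j σ b).det| l := by
  refine exists_congr fun σ => and_congr_right fun hσ => ⟨fun h => ⟨_, ?_, h⟩, ?_⟩
  · rw [mulVec_mulVec, mul_nonsing_inv _ (Ne.isUnit hσ), one_mulVec]
  · rintro ⟨t, rfl, ht⟩
    rwa [mulVec_mulVec, nonsing_inv_mul _ (Ne.isUnit hσ), one_mulVec]

theorem measurableSet_redSet (j : Fin d) :
    MeasurableSet {b : Fin d → Fin d → ℝ | b j ∈ redSet j b} := by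
  have hB : ∀ σ, Continuous fun b : Fin d → Fin d → ℝ => complMatrix j σ b := by
    intro σ
    refine Continuous.matrix_transpose (continuous_matrix fun l i => ?_)
    simp only [Matrix.of_apply]
    split_ifs
    · fun_prop
    · fun_prop
  have hset : {b : Fin d → Fin d → ℝ | b j ∈ redSet j b} = ⋃ σ : Fin d → Fin d,
      ({b | (complMatrix j σ b).det ≠ 0} ∩ ⋂ l, {b | |((complMatrix j σ b)⁻¹ *ᵥ b j) l| ≤
        redBound j |(complMatrix j σ b).det| l}) := by
    ext b
    simp [redSet]
  rw [hset]
  refine MeasurableSet.iUnion fun σ => ((hB σ).matrix_det.measurable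
    (measurableSet_singleton 0).compl).inter (MeasurableSet.iInter fun l => ?_)
  have hdet : Measurable fun b => (complMatrix j σ b).det := (hB σ).matrix_det.measurable
  refine measurableSet_le ?_ ?_
  · simp only [Matrix.inv_def, Ring.inverse_eq_inv', Matrix.smul_mulVec, Pi.smul_apply, smul_eq_mul]
    refine (hdet.inv.mul ?_).abs
    have : Continuous fun b : Fin d → Fin d → ℝ => ((complMatrix j σ b).adjugate *ᵥ b j) l :=
      (continuous_apply l).comp ((hB σ).matrix_adjugate.matrix_mulVec (continuous_apply j))
    exact this.measurable
  · unfold redBound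
    split_ifs
    · exact measurable_const
    · exact hdet.abs.const_div _
    · exact measurable_const

theorem volume_redSet_le (j : Fin d) (b : Fin d → Fin d → ℝ) :
    volume (redSet j b) ≤ (d ^ d : ℕ) * ENNReal.ofReal ((2 * 2 ^ d) ^ d) := by
  have hsub : redSet j b ⊆ ⋃ σ ∈ (Finset.univ : Finset (Fin d → Fin d)),
      {x | (complMatrix j σ b).det ≠ 0 ∧ ∃ t : Fin d → ℝ, x = complMatrix j σ b *ᵥ t ∧
        ∀ l, |t l| ≤ redBound j |(complMatrix j σ b).det| l} := by
    intro x hx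
    simpa using mem_redSet_iff.1 hx
  refine (measure_mono hsub).trans ((measure_biUnion_finset_le _ _).trans ?_)
  refine (Finset.sum_le_card_nsmul _ _ (ENNReal.ofReal ((2 * 2 ^ d) ^ d)) fun σ _ => ?_).trans ?_
  · set B := complMatrix j σ b
    by_cases hB : B.det = 0
    · simp [hB]
    set c := redBound j |B.det|
    have hc : ∀ l, 0 ≤ c l := redBound_nonneg j (abs_nonneg _)
    have h0 : 0 < |B.det| := abs_pos.2 hB
    refine (measure_mono (t := Matrix.toLin' B '' Set.Icc (-c) c) ?_).trans ?_
    · rintro x ⟨-, t, rfl, ht⟩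
      exact ⟨t, ⟨fun l => (abs_le.1 (ht l)).1, fun l => (abs_le.1 (ht l)).2⟩, by simp⟩
    · rw [Measure.addHaar_image_linearMap, Real.volume_Icc_pi, LinearMap.det_toLin',
        ← ENNReal.ofReal_prod_of_nonneg, ← ENNReal.ofReal_mul (abs_nonneg _)]
      · refine ENNReal.ofReal_le_ofReal ?_
        have h1 : ∀ l, c l - (-c) l = 2 * c l := fun l => by simp; ring
        simp_rw [h1]
        have hM : (1 : ℝ) ≤ 2 ^ d := one_le_pow₀ (by norm_num)
        rw [← Finset.mul_prod_erase _ _ (Finset.mem_univ j)]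
        have h2 : |B.det| * (2 * c j) = 2 * 2 ^ d := by
          simp only [c, redBound, lt_irrefl, if_false, if_true]
          field_simp
        rw [← mul_assoc, h2]
        have h3 : ∏ l ∈ Finset.univ.erase j, 2 * c l ≤ ∏ l ∈ Finset.univ.erase j, (2 * 2 ^ d) := by
          refine Finset.prod_le_prod (fun l _ => mul_nonneg zero_le_two (hc l)) fun l hl => ?_
          simp only [c, redBound, if_neg (Finset.ne_of_mem_erase hl)]
          split_ifs <;> linarith
        refine (mul_le_mul_of_nonneg_left h3 (by positivity)).trans_eq ?_
        rw [Finset.mul_prod_erase _ (fun _ => (2 * 2 ^ d : ℝ)) (Finset.mem_univ j)]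
        simp
      · intro l _
        have := hc l
        simp; linarith
  · simp

theorem smul_mem_redSet {j : Fin d} {b : Fin d → Fin d → ℝ} {x : Fin d → ℝ} (hx : x ∈ redSet j b)
    {s : ℝ} (hs : 0 < s) (hs1 : s ≤ 1) : s • x ∈ redSet j (s • b) := by
  obtain ⟨σ, hσ, t, rfl, ht⟩ := mem_redSet_iff.1 hx
  set δ : Fin d → ℝ := fun l => if l < j then s else 1 with hδ
  have hδ0 : ∀ l, 0 < δ l := fun l => by simp only [hδ]; split_ifs <;> linarith
  have hδ1 : ∀ l, δ l ≤ 1 := fun l => by simp only [hδ]; split_ifs <;> linarith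
  have hB : complMatrix j σ (s • b) = complMatrix j σ b * diagonal δ := by
    ext i l
    rw [mul_diagonal]
    by_cases h : l < j <;> simp [complMatrix, hδ, h, mul_comm]
  have hdet : (complMatrix j σ (s • b)).det = (complMatrix j σ b).det * ∏ l, δ l := by
    rw [hB, det_mul, det_diagonal]
  have hP : 0 < ∏ l, δ l := Finset.prod_pos fun l _ => hδ0 l
  have hP1 : ∏ l, δ l ≤ 1 := Finset.prod_le_one (fun l _ => (hδ0 l).le) fun l _ => hδ1 l
  have hdet0 : (complMatrix j σ (s • b)).det ≠ 0 := hdet ▸ mul_ne_zero hσ hP.ne'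
  have hdetle : |(complMatrix j σ (s • b)).det| ≤ |(complMatrix j σ b).det| := by
    rw [hdet, abs_mul, abs_of_pos hP]
    exact mul_le_of_le_one_right (abs_nonneg _) hP1
  refine mem_redSet_iff.2 ⟨σ, hdet0, fun l => if l < j then t l else s * t l, ?_, fun l => ?_⟩
  · rw [hB, ← mulVec_mulVec, ← mulVec_smul]
    congr 1
    ext l
    rw [mulVec_diagonal]
    by_cases h : l < j <;> simp [hδ, h]
  · have h1 := ht l
    have h2 : |s * t l| ≤ |t l| := by
      rw [abs_mul, abs_of_pos hs]
      exact mul_le_of_le_one_left (abs_nonneg _) hs1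
    have h3 : 0 < |(complMatrix j σ (s • b)).det| := abs_pos.2 hdet0
    rcases lt_trichotomy l j with h | h | h
    · simpa [redBound, h] using h1
    · subst h
      simp only [redBound, lt_irrefl, if_false, if_true] at h1 ⊢
      exact (h2.trans h1).trans (by gcongr)
    · simp only [redBound, h.not_gt, h.ne', if_false] at h1 ⊢
      exact h2.trans h1

/-- The columns of a matrix. -/
def cols (g : SLR d) : Fin d → Fin d → ℝ := fun j i => g.1 i j

/-- The embedding of `SL_d(ℤ)` in `SL_d(ℝ)`. -/
def toR : Matrix.SpecialLinearGroup (Fin d) ℤ →* SLR d :=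
  Matrix.SpecialLinearGroup.map (n := Fin d) (Int.castRingHom ℝ)

theorem toR_apply (γ : Matrix.SpecialLinearGroup (Fin d) ℤ) (i j : Fin d) :
    (toR γ).1 i j = (γ.1 i j : ℝ) := rfl

theorem cols_mul (g h : SLR d) (j : Fin d) : cols (g * h) j = g.1 *ᵥ cols h j := rfl

theorem cols_mul_toR_of_fixesFirst {k : ℕ} (g : SLR d) {γ : Matrix.SpecialLinearGroup (Fin d) ℤ}
    (hγ : FixesFirst k γ) {j : Fin d} (hj : (j : ℕ) < k) : cols (g * toR γ) j = cols g j := by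
  rw [cols_mul]
  have : cols (toR γ) j = cols 1 j := by
    ext i
    simp only [cols, toR_apply, hγ j hj]
    simp [Matrix.one_apply]
  rw [this, ← cols_mul, mul_one]

theorem transpose_of_cols (g : SLR d) : (Matrix.of (cols g))ᵀ = g.1 := rfl

theorem mulVec_eq_sum_cols (g : SLR d) (v : Fin d → ℝ) : g.1 *ᵥ v = ∑ l, v l • cols g l := by
  ext i
  simp [Matrix.mulVec, dotProduct, cols, mul_comm]

theorem complMatrix_mulVec (k : ℕ) (σ : Fin d → Fin d) (b : Fin d → Fin d → ℝ) (v : Fin d → ℝ)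
    (hv : ∀ l : Fin d, k ≤ (l : ℕ) → v l = 0) : complMatrix k σ b *ᵥ v = ∑ l, v l • b l := by
  ext i
  simp only [Matrix.mulVec, dotProduct, Finset.sum_apply, Pi.smul_apply, smul_eq_mul]
  refine Finset.sum_congr rfl fun l _ => ?_
  rcases lt_or_ge (l : ℕ) k with h | h
  · simp [complMatrix, h, mul_comm]
  · simp [hv l h]

theorem exists_fixesFirst_mem_redSet (j : Fin d) (g : SLR d) :
    ∃ γ : Matrix.SpecialLinearGroup (Fin d) ℤ, FixesFirst j γ ∧
      cols (g * toR γ) j ∈ redSet j (cols g) := by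
  obtain ⟨σ, hσ⟩ := exists_complMatrix_det_ne_zero (cols g)
    (by rw [transpose_of_cols, g.2]; exact one_ne_zero) j
  set B := complMatrix j σ (cols g) with hBdef
  have hB0 : 0 < |B.det| := abs_pos.2 hσ
  have hBu : IsUnit B.det := Ne.isUnit hσ
  set c := redBound j |B.det| with hc
  have hdet : (B⁻¹ * g.1).det = B.det⁻¹ := by
    rw [det_mul, g.2, mul_one, det_nonsing_inv, Ring.inverse_eq_inv']
  obtain ⟨w, hw0, hw⟩ := exists_int_abs_mulVec_le (B⁻¹ * g.1)
    (by rw [hdet]; exact inv_ne_zero hσ) c (redBound_nonneg j hB0.le) (by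
      rw [hdet, abs_inv, ← one_div, div_lt_iff₀ hB0, mul_comm,
        ← Finset.mul_prod_erase _ _ (Finset.mem_univ j), ← mul_assoc]
      have h2 : |B.det| * c j = 2 ^ d := by
        simp only [c, redBound, lt_irrefl, if_false, if_true]
        field_simp
      have hM : (1 : ℝ) ≤ 2 ^ d := one_le_pow₀ (by norm_num)
      have h3 : ∏ l ∈ Finset.univ.erase j, (1 / 2 : ℝ) ≤ ∏ l ∈ Finset.univ.erase j, c l := by
        refine Finset.prod_le_prod (fun l _ => by norm_num) fun l hl => ?_
        simp only [c, redBound, if_neg (Finset.ne_of_mem_erase hl)]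
        split_ifs <;> linarith
      rw [h2]
      refine lt_of_lt_of_le ?_ (mul_le_mul_of_nonneg_left h3 (by positivity))
      have h4 : (1 / 2 : ℝ) * ∏ l ∈ Finset.univ.erase j, (1 / 2 : ℝ) = (1 / 2) ^ d := by
        rw [Finset.mul_prod_erase _ (fun _ => (1 / 2 : ℝ)) (Finset.mem_univ j)]
        simp
      have h5 : (2 : ℝ) ^ d * (1 / 2) ^ d = 1 := by rw [← mul_pow]; norm_num
      nlinarith)
  set wR : Fin d → ℝ := fun i => (w i : ℝ)
  set t : Fin d → ℝ := (B⁻¹ * g.1) *ᵥ wR with ht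
  have hBt : B *ᵥ t = g.1 *ᵥ wR := by
    rw [ht, mulVec_mulVec, mul_nonsing_inv_cancel_left _ _ hBu]
  have hex : ∃ i, j ≤ i ∧ w i ≠ 0 := by
    by_contra! hcon
    have h1 : B *ᵥ wR = g.1 *ᵥ wR := by
      rw [hBdef, complMatrix_mulVec _ _ _ _ fun l hl => ?_, mulVec_eq_sum_cols]
      simp [wR, hcon l hl]
    have h2 : t = wR := by
      rw [ht, ← mulVec_mulVec, ← h1, mulVec_mulVec, nonsing_inv_mul _ hBu, one_mulVec]
    apply hw0
    ext l
    rcases le_or_gt j l with hl | hl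
    · exact hcon l hl
    · have h3 : |t l| ≤ c l := hw l
      rw [h2] at h3
      simp only [c, redBound, if_pos hl, wR] at h3
      have h4 : |w l| < 1 := by
        have : ((|w l| : ℤ) : ℝ) < 1 := by push_cast; linarith
        exact_mod_cast this
      exact Int.abs_lt_one_iff.1 h4
  obtain ⟨n, hn, H⟩ := exists_fixesFirst_column j w hex
  obtain ⟨γ, hγ, θ, hθ, hτ, hcol⟩ := H fun l => t l / n
  have hn' : (n : ℝ) ≠ 0 := by exact_mod_cast hn
  have hn1 : (1 : ℝ) ≤ |(n : ℝ)| := by exact_mod_cast Int.one_le_abs hn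
  refine ⟨γ, hγ, mem_redSet_iff.2 ⟨σ, hσ, fun l => t l / n + θ l, ?_, fun l => ?_⟩⟩
  · have h1 : cols (toR γ) j = (n : ℝ)⁻¹ • wR + θ := by
      ext l
      simp only [cols, toR_apply, hcol, wR, Pi.add_apply, Pi.smul_apply, smul_eq_mul]
      ring
    have h2 : (fun l => t l / n + θ l) = (n : ℝ)⁻¹ • t + θ := by
      ext l
      simp only [Pi.add_apply, Pi.smul_apply, smul_eq_mul]
      ring
    rw [cols_mul, h1, h2, mulVec_add, mulVec_add, mulVec_smul, mulVec_smul, hBt,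
      complMatrix_mulVec _ _ _ θ (fun l hl => hθ l hl), mulVec_eq_sum_cols g θ]
  · rcases lt_or_ge l j with h | h
    · simpa [redBound, h] using hτ l h
    · simp only [hθ l h, add_zero]
      refine le_trans ?_ (hw l)
      rw [abs_div]
      exact div_le_self (abs_nonneg _) hn1

/-- Every basis can be completed, keeping its first `k` vectors, to a reduced one. -/
theorem exists_fixesFirst_forall_mem_redSet (k : ℕ) (g : SLR d) :
    ∃ γ : Matrix.SpecialLinearGroup (Fin d) ℤ, FixesFirst k γ ∧
      ∀ j : Fin d, k ≤ (j : ℕ) → cols (g * toR γ) j ∈ redSet j (cols (g * toR γ)) := by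
  suffices h : ∀ m : ℕ, k ≤ m → ∃ γ : Matrix.SpecialLinearGroup (Fin d) ℤ, FixesFirst k γ ∧
      ∀ j : Fin d, k ≤ (j : ℕ) → (j : ℕ) < m →
        cols (g * toR γ) j ∈ redSet j (cols (g * toR γ)) by
    obtain ⟨γ, hγ, H⟩ := h (max k d) (le_max_left _ _)
    exact ⟨γ, hγ, fun j hj => H j hj (j.isLt.trans_le (le_max_right _ _))⟩
  intro m hm
  induction m, hm using Nat.le_induction with
  | base => exact ⟨1, FixesFirst.one k, fun j h1 h2 => absurd h2 h1.not_gt⟩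
  | succ m hm ih =>
    obtain ⟨γ, hγ, H⟩ := ih
    rcases le_or_gt d m with hd | hd
    · exact ⟨γ, hγ, fun j h1 _ => H j h1 (j.isLt.trans_le hd)⟩
    obtain ⟨γ', hγ', H'⟩ := exists_fixesFirst_mem_redSet ⟨m, hd⟩ (g * toR γ)
    refine ⟨γ * γ', hγ.mul (hγ'.mono hm), fun j h1 h2 => ?_⟩
    rw [map_mul, ← mul_assoc]
    have hcongr : redSet j (cols (g * toR γ * toR γ')) = redSet j (cols (g * toR γ)) :=
      redSet_congr fun i hi => cols_mul_toR_of_fixesFirst _ hγ'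
        (by have : (i : ℕ) < j := hi; simp only; omega)
    rw [hcongr]
    rcases (Nat.lt_succ_iff.1 h2).lt_or_eq with h | h
    · rw [cols_mul_toR_of_fixesFirst _ hγ' (by exact h)]
      exact H j h1 h
    · have : j = ⟨m, hd⟩ := Fin.ext h
      rw [this]
      exact H'

end Reduction

section Volume

/-- Volume of a family of tuples in which each entry is constrained by the previous ones. -/
theorem volume_setOf_forall_mem_le {X : Type*} [MeasureSpace X] [SigmaFinite (volume : Measure X)]
    [Inhabited X] (n : ℕ) (T : Fin n → (Fin n → X) → Set X) (v : Fin n → ENNReal)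
    (hT : ∀ j b b', (∀ i < j, b i = b' i) → T j b = T j b')
    (hm : ∀ j, MeasurableSet {b | b j ∈ T j b}) (hv : ∀ j b, volume (T j b) ≤ v j) :
    volume {b | ∀ j, b j ∈ T j b} ≤ ∏ j, v j := by
  induction n with
  | zero =>
    rw [volume_pi]
    refine (measure_mono (Set.subset_univ _)).trans ?_
    simp
  | succ n ih =>
    have hsn : Measurable fun b : Fin n → X => (Fin.snoc b default : Fin (n + 1) → X) := by
      refine measurable_pi_lambda _ fun i => ?_
      refine Fin.lastCases ?_ (fun i => ?_) i
      · simp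
      · simpa using measurable_pi_apply i
    set T' : Fin n → (Fin n → X) → Set X := fun j b => T j.castSucc (Fin.snoc b default) with hT'
    have h1 := ih T' (fun j => v j.castSucc) (fun j b b' h => hT _ _ _ fun i hi => by
        have hi' : (i : ℕ) < n := lt_trans (show (i : ℕ) < j from hi) j.isLt
        obtain ⟨i, rfl⟩ : ∃ i' : Fin n, i = i'.castSucc := ⟨⟨i, hi'⟩, rfl⟩
        simpa using h i (by simpa using hi))
      (fun j => by simpa [hT'] using hsn (hm j.castSucc)) fun j b => hv _ _
    set S' : Set (Fin n → X) := {b | ∀ j, b j ∈ T' j b}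
    set U : Set (Fin n → X) := toMeasurable volume S'
    set e := MeasurableEquiv.piFinSuccAbove (fun _ : Fin (n + 1) => X) (Fin.last n)
    have he : MeasurePreserving e volume volume := volume_preserving_piFinSuccAbove _ _
    have hed : ∀ b, (e b).2 = Fin.init b := fun b => by
      ext i; simp [e, MeasurableEquiv.piFinSuccAbove, Fin.init]
    have hagree : ∀ b : Fin (n + 1) → X, ∀ j, T j b = T j (Fin.snoc (Fin.init b) default) :=
      fun b j => hT _ _ _ fun i hi => by
        obtain ⟨i, rfl⟩ := Fin.exists_castSucc_eq.2 (hi.trans_le (Fin.le_last j)).ne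
        simp [Fin.init]
    have hM : MeasurableSet {b : Fin (n + 1) → X | b (Fin.last n) ∈ T (Fin.last n) b} := hm _
    have hsub : {b | ∀ j, b j ∈ T j b} ⊆ e ⁻¹' {p | p.2 ∈ U ∧
        p ∈ e.symm ⁻¹' {b : Fin (n + 1) → X | b (Fin.last n) ∈ T (Fin.last n) b}} := by
      intro b hb
      refine ⟨subset_toMeasurable _ _ fun j => ?_, ?_⟩
      · rw [hed]
        simpa [hT', ← hagree, Fin.init] using hb j.castSucc
      · simpa using hb (Fin.last n)
    have hUm : MeasurableSet U := measurableSet_toMeasurable _ _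
    have hPm : MeasurableSet {p : X × (Fin n → X) | p.2 ∈ U ∧
        p ∈ e.symm ⁻¹' {b : Fin (n + 1) → X | b (Fin.last n) ∈ T (Fin.last n) b}} :=
      (measurable_snd hUm).inter (e.symm.measurable hM)
    refine (measure_mono hsub).trans ?_
    rw [he.measure_preimage hPm.nullMeasurableSet, Measure.volume_eq_prod,
      Measure.prod_apply_symm hPm, Fin.prod_univ_castSucc]
    calc _ ≤ ∫⁻ b, U.indicator (fun _ => v (Fin.last n)) b := by
          refine lintegral_mono fun b => ?_
          by_cases hb : b ∈ U
          · rw [Set.indicator_of_mem hb]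
            refine (measure_mono fun x hx => ?_).trans (hv (Fin.last n) (Fin.snoc b default))
            have h2 := hx.2
            have h3 : e (e.symm (x, b)) = (x, b) := e.apply_symm_apply _
            have h4 : (e.symm (x, b)) (Fin.last n) = x := congrArg Prod.fst h3
            have h5 : Fin.init (e.symm (x, b)) = b := by rw [← hed, h3]
            simp only [Set.mem_preimage, Set.mem_ofPred_eq, h4] at h2
            rw [hagree, h5] at h2
            exact h2
          · rw [Set.indicator_of_notMem hb]
            refine le_of_eq (measure_mono_null (fun x hx => ?_) measure_empty)
            exact hb hx.1
      _ = v (Fin.last n) * volume S' := by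
          rw [lintegral_indicator_const hUm, measure_toMeasurable]
      _ ≤ _ := by rw [mul_comm]; gcongr

variable {d : ℕ}

/-- The open Euclidean ball in `Fin d → ℝ`. -/
def euclBall (d : ℕ) (r : ℝ) : Set (Fin d → ℝ) := {x | ‖WithLp.toLp 2 x‖ < r}

theorem mem_euclBall {r : ℝ} {x : Fin d → ℝ} : x ∈ euclBall d r ↔ ‖WithLp.toLp 2 x‖ < r := Iff.rfl

theorem euclBall_eq (r : ℝ) :
    euclBall d r = WithLp.toLp 2 ⁻¹' Metric.ball (0 : EuclideanSpace ℝ (Fin d)) r := by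
  ext x
  simp [euclBall]

theorem isOpen_euclBall (r : ℝ) : IsOpen (euclBall d r) := by
  rw [euclBall_eq]
  exact Metric.isOpen_ball.preimage (PiLp.continuous_toLp 2 _)

theorem measurableSet_euclBall (r : ℝ) : MeasurableSet (euclBall d r) :=
  (isOpen_euclBall r).measurableSet

theorem volume_euclBall (hd : d ≠ 0) {r : ℝ} (hr : 0 ≤ r) :
    volume (euclBall d r) = ENNReal.ofReal r ^ d * volume (euclBall d 1) := by
  have : Nonempty (Fin d) := ⟨⟨0, Nat.pos_of_ne_zero hd⟩⟩
  rw [euclBall_eq, euclBall_eq, (PiLp.volume_preserving_toLp _).measure_preimage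
    measurableSet_ball.nullMeasurableSet, (PiLp.volume_preserving_toLp _).measure_preimage
    measurableSet_ball.nullMeasurableSet, Measure.addHaar_ball _ _ hr, ENNReal.ofReal_pow hr]
  simp

theorem volume_euclBall_one_lt_top : volume (euclBall d 1) < ⊤ := by
  rw [euclBall_eq, (PiLp.volume_preserving_toLp _).measure_preimage
    measurableSet_ball.nullMeasurableSet]
  exact measure_ball_lt_top

/-- Reduced bases whose first `k` vectors have norm `< 2 r`. -/
def redFam (d k : ℕ) (r : ℝ) : Set (Fin d → Fin d → ℝ) :=
  {b | ∀ j : Fin d, b j ∈ if (j : ℕ) < k then euclBall d (2 * r) else redSet j b}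

theorem measurableSet_redFam (k : ℕ) (r : ℝ) : MeasurableSet (redFam d k r) := by
  have : redFam d k r = ⋂ j : Fin d,
      {b | b j ∈ if (j : ℕ) < k then euclBall d (2 * r) else redSet j b} := by
    ext b; simp [redFam]
  rw [this]
  refine MeasurableSet.iInter fun j => ?_
  split_ifs
  · exact measurable_pi_apply j (measurableSet_euclBall _)
  · exact measurableSet_redSet j

theorem exists_volume_redFam_le (hd : d ≠ 0) {k : ℕ} (hk : k ≤ d) :
    ∃ K : ENNReal, K ≠ ⊤ ∧ ∀ r : ℝ, 0 ≤ r →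
      volume (redFam d k r) ≤ K * ENNReal.ofReal r ^ (d * k) := by
  set V : ENNReal := (d ^ d : ℕ) * ENNReal.ofReal ((2 * 2 ^ d) ^ d)
  set E : ENNReal := ENNReal.ofReal 2 ^ d * volume (euclBall d 1)
  have hV : V ≠ ⊤ := ENNReal.mul_ne_top (by simp) ENNReal.ofReal_ne_top
  have hE : E ≠ ⊤ := ENNReal.mul_ne_top (by simp) volume_euclBall_one_lt_top.ne
  refine ⟨∏ j : Fin d, if (j : ℕ) < k then E else V, ?_, fun r hr => ?_⟩
  · refine ENNReal.prod_ne_top fun j _ => ?_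
    split_ifs <;> assumption
  · refine (volume_setOf_forall_mem_le d
      (fun j b => if (j : ℕ) < k then euclBall d (2 * r) else redSet j b)
      (fun j => (if (j : ℕ) < k then E else V) *
        (if (j : ℕ) < k then ENNReal.ofReal r ^ d else 1)) ?_ ?_ ?_).trans_eq ?_
    · intro j b b' h
      simp only [redSet_congr h]
    · intro j
      split_ifs
      · exact measurable_pi_apply j (measurableSet_euclBall _)
      · exact measurableSet_redSet j
    · intro j b
      split_ifs
      · rw [volume_euclBall hd (by positivity), ENNReal.ofReal_mul (by norm_num), mul_pow]
        exact le_of_eq (by ring)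
      · rw [mul_one]
        exact volume_redSet_le j b
    · rw [Finset.prod_mul_distrib]
      congr 1
      rw [Finset.prod_ite, Finset.prod_const, Finset.prod_const_one, mul_one, ← pow_mul,
        Fin.card_filter_val_lt, min_eq_right hk]

theorem smul_mem_redFam {k : ℕ} {r : ℝ} {b : Fin d → Fin d → ℝ} (hb : b ∈ redFam d k r)
    {s : ℝ} (hs : 0 < s) (hs1 : s ≤ 1) : s • b ∈ redFam d k r := by
  intro j
  have h := hb j
  split_ifs with hj
  · rw [if_pos hj, mem_euclBall] at h
    rw [mem_euclBall]
    refine lt_of_le_of_lt ?_ h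
    rw [Pi.smul_apply, WithLp.toLp_smul, norm_smul, Real.norm_of_nonneg hs.le]
    exact mul_le_of_le_one_left (norm_nonneg _) hs1
  · rw [if_neg hj] at h
    exact smul_mem_redSet h hs hs1

end Volume

section Topology

variable {d : ℕ}

instance : BorelSpace (Matrix (Fin d) (Fin d) ℝ) :=
  inferInstanceAs (BorelSpace (Fin d → Fin d → ℝ))

instance : BorelSpace (SLR d) :=
  inferInstanceAs (BorelSpace {A : Matrix (Fin d) (Fin d) ℝ // A.det = 1})

instance : SecondCountableTopology (Matrix (Fin d) (Fin d) ℝ) :=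
  inferInstanceAs (SecondCountableTopology (Fin d → Fin d → ℝ))

instance : SecondCountableTopology (SLR d) :=
  TopologicalSpace.Subtype.secondCountableTopology _

instance : MeasurableMul₂ (SLR d) := inferInstance

instance : MeasurableInv (SLR d) := inferInstance

instance : Countable (Matrix (Fin d) (Fin d) ℤ) :=
  inferInstanceAs (Countable (Fin d → Fin d → ℤ))

instance : Countable (Matrix.SpecialLinearGroup (Fin d) ℤ) := Subtype.countable

theorem measurable_cols : Measurable (cols : SLR d → Fin d → Fin d → ℝ) :=
  measurable_pi_lambda _ fun j => measurable_pi_lambda _ fun i =>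
    (measurable_pi_apply j).comp ((measurable_pi_apply i).comp measurable_subtype_coe)

theorem continuous_entry (i j : Fin d) : Continuous fun g : SLR d => g.1 i j :=
  (continuous_apply_apply i j).comp continuous_subtype_val

theorem exists_nhds_one : ∃ V : Set (SLR d), IsOpen V ∧ 1 ∈ V ∧
    (∀ g ∈ V, ∀ i j, |g.1 i j| < 2) ∧
    ∀ g γ, g ∈ V → g * toR γ ∈ V → γ = 1 := by
  set U : Set (SLR d) := {g | ∀ i j, |g.1 i j - (1 : Matrix (Fin d) (Fin d) ℝ) i j| < 1} with hU
  have hUo : IsOpen U := by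
    have : U = ⋂ i, ⋂ j, {g : SLR d | |g.1 i j - (1 : Matrix (Fin d) (Fin d) ℝ) i j| < 1} := by
      ext; simp [hU]
    rw [this]
    exact isOpen_iInter_of_finite fun i => isOpen_iInter_of_finite fun j =>
      isOpen_lt ((continuous_entry i j).sub continuous_const).abs continuous_const
  have hU1 : (1 : SLR d) ∈ U := by intro i j; simp
  have hUZ : ∀ γ, toR γ ∈ U → γ = 1 := by
    intro γ hγ
    ext i j
    have h1 := hγ i j
    rw [toR_apply] at h1
    have h2 : ((1 : Matrix (Fin d) (Fin d) ℝ) i j) = ((1 : Matrix (Fin d) (Fin d) ℤ) i j : ℤ) := by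
      by_cases h : i = j <;> simp [h, Matrix.one_apply]
    rw [h2] at h1
    have h3 : |γ.1 i j - (1 : Matrix (Fin d) (Fin d) ℤ) i j| < 1 := by exact_mod_cast h1
    have := Int.abs_lt_one_iff.1 h3
    exact sub_eq_zero.1 this
  have hcont : Continuous fun p : SLR d × SLR d => p.1⁻¹ * p.2 := by fun_prop
  have hnhds : (fun p : SLR d × SLR d => p.1⁻¹ * p.2) ⁻¹' U ∈ nhds ((1, 1) : SLR d × SLR d) :=
    (hUo.preimage hcont).mem_nhds (by simpa using hU1)
  rw [nhds_prod_eq, Filter.mem_prod_self_iff] at hnhds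
  obtain ⟨t, ht, hsub⟩ := hnhds
  obtain ⟨V, hVt, hVo, hV1⟩ := mem_nhds_iff.1 ht
  refine ⟨V ∩ U, hVo.inter hUo, ⟨hV1, hU1⟩, ?_, ?_⟩
  · intro g hg i j
    have h1 := hg.2 i j
    have h2 : |(1 : Matrix (Fin d) (Fin d) ℝ) i j| ≤ 1 := by
      by_cases h : i = j <;> simp [h, Matrix.one_apply]
    have h3 := abs_add_le (g.1 i j - (1 : Matrix (Fin d) (Fin d) ℝ) i j)
      ((1 : Matrix (Fin d) (Fin d) ℝ) i j)
    rw [sub_add_cancel] at h3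
    linarith
  · intro g γ hg hgγ
    apply hUZ
    have := hsub (Set.mk_mem_prod (hVt hg.1) (hVt hgγ.1))
    simpa using this

theorem sigmaFinite_of_isMulLeftInvariant {G : Type*} [Group G] [TopologicalSpace G]
    [IsTopologicalGroup G] [SecondCountableTopology G] [MeasurableSpace G] [BorelSpace G]
    (m : Measure G) [m.IsMulLeftInvariant] {V : Set G} (hV : IsOpen V) (h1 : 1 ∈ V)
    (hm : m V < ⊤) : SigmaFinite m := by
  have : IsLocallyFiniteMeasure m := ⟨fun g => by
    refine ⟨(fun x => g⁻¹ * x) ⁻¹' V, ?_, ?_⟩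
    · exact (hV.preimage (continuous_const_mul g⁻¹)).mem_nhds (by simpa using h1)
    · rwa [measure_preimage_mul]⟩
  infer_instance

end Topology

section Lift

variable {d : ℕ}

/-- The sum of a function on `SL_d(ℝ)` over a coset of `SL_d(ℤ)`. -/
def orbSum (f : SLR d → ENNReal) (x : LatticeSpace d) : ENNReal :=
  ∑' γ : Matrix.SpecialLinearGroup (Fin d) ℤ, f (x.out * toR γ)

theorem orbSum_mk (f : SLR d → ENNReal) (g : SLR d) :
    orbSum f (QuotientGroup.mk g) = ∑' γ : Matrix.SpecialLinearGroup (Fin d) ℤ, f (g * toR γ) := by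
  obtain ⟨⟨h, γ₀, rfl⟩, hh⟩ := QuotientGroup.mk_out_eq_mul (SLZ d) g
  rw [orbSum, hh]
  rw [← (Equiv.mulLeft γ₀).tsum_eq fun γ => f (g * toR γ)]
  refine tsum_congr fun γ => ?_
  simp [toR, mul_assoc]

theorem measurable_orbSum {f : SLR d → ENNReal} (hf : Measurable f) : Measurable (orbSum f) := by
  refine QuotientGroup.measurable_from_quotient.2 ?_
  have : orbSum f ∘ ((↑) : SLR d → LatticeSpace d) = fun g => ∑' γ, f (g * toR γ) :=
    funext fun g => orbSum_mk f g
  rw [this]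
  exact Measurable.tsum fun γ => hf.comp (measurable_mul_const _)

/-- The lift to `SL_d(ℝ)` of a measure on the space of lattices. -/
def liftMeasure (μ : Measure (LatticeSpace d)) : Measure (SLR d) :=
  Measure.ofMeasurable (fun A _ => ∫⁻ x, orbSum (A.indicator 1) x ∂μ) (by simp [orbSum]) (by
    intro A hA hd
    rw [← lintegral_tsum fun i =>
      (measurable_orbSum (measurable_one.indicator (hA i))).aemeasurable]
    refine lintegral_congr fun x => ?_
    simp only [orbSum]
    rw [ENNReal.tsum_comm]
    refine tsum_congr fun γ => ?_
    have := measure_iUnion (μ := Measure.dirac (x.out * toR γ)) hd hA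
    rw [Measure.dirac_apply' _ (MeasurableSet.iUnion hA)] at this
    exact this.trans (tsum_congr fun i => Measure.dirac_apply' _ (hA i)))

theorem liftMeasure_apply (μ : Measure (LatticeSpace d)) {A : Set (SLR d)} (hA : MeasurableSet A) :
    liftMeasure μ A = ∫⁻ x, orbSum (A.indicator 1) x ∂μ :=
  Measure.ofMeasurable_apply _ hA

theorem measurable_smul_latticeSpace (g : SLR d) :
    Measurable fun x : LatticeSpace d => g • x :=
  QuotientGroup.measurable_from_quotient.2
    (QuotientGroup.measurable_coe.comp (measurable_const_mul g))

theorem lintegral_smul_latticeSpace {μ : Measure (LatticeSpace d)}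
    (hinv : ∀ (g : SLR d) (s : Set (LatticeSpace d)), μ ((g • ·) ⁻¹' s) = μ s) (g : SLR d)
    {F : LatticeSpace d → ENNReal} (hF : Measurable F) : ∫⁻ x, F (g • x) ∂μ = ∫⁻ x, F x ∂μ := by
  have : μ.map (fun x => g • x) = μ :=
    Measure.ext fun s hs => by rw [Measure.map_apply (measurable_smul_latticeSpace g) hs, hinv]
  conv_rhs => rw [← this]
  rw [lintegral_map hF (measurable_smul_latticeSpace g)]

theorem isMulLeftInvariant_liftMeasure {μ : Measure (LatticeSpace d)}
    (hinv : ∀ (g : SLR d) (s : Set (LatticeSpace d)), μ ((g • ·) ⁻¹' s) = μ s) :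
    (liftMeasure μ).IsMulLeftInvariant := ⟨fun g => by
  ext A hA
  rw [Measure.map_apply (measurable_const_mul g) hA, liftMeasure_apply μ hA,
    liftMeasure_apply μ (measurable_const_mul g hA),
    ← lintegral_smul_latticeSpace hinv g (measurable_orbSum (measurable_one.indicator hA))]
  refine lintegral_congr fun x => ?_
  induction x using QuotientGroup.induction_on with
  | H h =>
    have : g • (QuotientGroup.mk h : LatticeSpace d) = QuotientGroup.mk (g * h) := rfl
    rw [this, orbSum_mk, orbSum_mk]
    refine tsum_congr fun γ => ?_
    rw [mul_assoc]
    rfl⟩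

theorem liftMeasure_le_one (μ : Measure (LatticeSpace d)) [IsProbabilityMeasure μ]
    {V : Set (SLR d)} (hV : MeasurableSet V)
    (h : ∀ g γ, g ∈ V → g * toR γ ∈ V → γ = 1) : liftMeasure μ V ≤ 1 := by
  rw [liftMeasure_apply μ hV]
  have hle : ∀ x, orbSum (V.indicator 1) x ≤ 1 := by
    intro x
    unfold orbSum
    by_cases hex : ∃ γ, x.out * toR γ ∈ V
    · obtain ⟨γ, hγ⟩ := hex
      rw [tsum_eq_single γ]
      · exact Set.indicator_le_self _ _ _
      · intro γ' hne
        refine Set.indicator_of_notMem (fun hmem => hne ?_) _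
        have := h _ (γ⁻¹ * γ') hγ (by rw [map_mul, map_inv]; simpa [mul_assoc] using hmem)
        exact (inv_mul_eq_one.1 this).symm
    · push Not at hex
      rw [ENNReal.tsum_eq_zero.2 fun γ => Set.indicator_of_notMem (hex γ) _]
      exact zero_le_one
  calc _ ≤ ∫⁻ _, 1 ∂μ := lintegral_mono hle
    _ = 1 := by simp

end Lift

section Cone

open Matrix

variable {d : ℕ}

/-- The normalization to determinant one of a matrix given by its columns. -/
def normCols (b : Fin d → Fin d → ℝ) : SLR d :=
  if h : 0 < (Matrix.of b).det ∧ d ≠ 0 then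
    ⟨((Matrix.of b).det ^ (d : ℝ)⁻¹)⁻¹ • (Matrix.of b)ᵀ, by
      have h0 : (d : ℝ) ≠ 0 := by exact_mod_cast h.2
      rw [det_smul, det_transpose, Fintype.card_fin, inv_pow, ← Real.rpow_natCast,
        ← Real.rpow_mul h.1.le, inv_mul_cancel₀ h0, Real.rpow_one, inv_mul_cancel₀ h.1.ne']⟩
  else 1

theorem normCols_val {b : Fin d → Fin d → ℝ} (h : 0 < (Matrix.of b).det ∧ d ≠ 0) :
    (normCols b).1 = ((Matrix.of b).det ^ (d : ℝ)⁻¹)⁻¹ • (Matrix.of b)ᵀ :=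
  congrArg Subtype.val (dif_pos h)

theorem normCols_eq_one {b : Fin d → Fin d → ℝ} (h : ¬(0 < (Matrix.of b).det ∧ d ≠ 0)) :
    normCols b = 1 := dif_neg h

theorem cols_normCols {b : Fin d → Fin d → ℝ} (h : 0 < (Matrix.of b).det) (hd : d ≠ 0) :
    cols (normCols b) = ((Matrix.of b).det ^ (d : ℝ)⁻¹)⁻¹ • b := by
  ext j i
  simp [cols, normCols_val ⟨h, hd⟩]

theorem cols_injective : Function.Injective (cols : SLR d → Fin d → Fin d → ℝ) := by
  intro g h hgh
  ext i j
  exact congrFun (congrFun hgh j) i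

theorem continuous_det_of : Continuous fun b : Fin d → Fin d → ℝ => (Matrix.of b).det :=
  Continuous.matrix_det continuous_id

theorem measurable_normCols : Measurable (normCols : (Fin d → Fin d → ℝ) → SLR d) := by
  refine Measurable.subtype_mk (f := fun b => (normCols b).1) ?_
  refine measurable_pi_lambda _ fun i => measurable_pi_lambda _ fun j => ?_
  have : (fun b : Fin d → Fin d → ℝ => (normCols b).1 i j) = fun b =>
      if 0 < (Matrix.of b).det ∧ d ≠ 0 then ((Matrix.of b).det ^ (d : ℝ)⁻¹)⁻¹ * b j i
      else (1 : Matrix (Fin d) (Fin d) ℝ) i j := by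
    ext b
    by_cases h : 0 < (Matrix.of b).det ∧ d ≠ 0
    · rw [normCols_val h, if_pos h]
      simp
    · rw [normCols_eq_one h, if_neg h]
      rfl
  rw [this]
  refine Measurable.ite ?_ ?_ measurable_const
  · by_cases hd : d = 0
    · simp [hd]
    · simpa [hd] using measurableSet_lt measurable_const continuous_det_of.measurable
  · exact ((continuous_det_of.measurable.pow_const _).inv).mul
      ((measurable_pi_apply i).comp (measurable_pi_apply j))

/-- The matrices, given by columns, with determinant in `(0, 1]`. -/
def detSet (d : ℕ) : Set (Fin d → Fin d → ℝ) := {b | 0 < (Matrix.of b).det ∧ (Matrix.of b).det ≤ 1}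

theorem measurableSet_detSet : MeasurableSet (detSet d) :=
  (measurableSet_lt measurable_const continuous_det_of.measurable).inter
    (measurableSet_le continuous_det_of.measurable measurable_const)

/-- The cone measure on `SL_d(ℝ)`. -/
def coneMeasure (d : ℕ) : Measure (SLR d) := (volume.restrict (detSet d)).map normCols

theorem coneMeasure_apply {A : Set (SLR d)} (hA : MeasurableSet A) :
    coneMeasure d A = volume (normCols ⁻¹' A ∩ detSet d) := by
  rw [coneMeasure, Measure.map_apply measurable_normCols hA,
    Measure.restrict_apply (measurable_normCols hA)]

theorem measurePreserving_mulVec (g : SLR d) :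
    MeasurePreserving (fun b : Fin d → Fin d → ℝ => fun j => g.1 *ᵥ b j) volume volume := by
  refine volume_preserving_pi fun _ => ⟨?_, ?_⟩
  · exact (Continuous.matrix_mulVec continuous_const continuous_id).measurable
  · have := Real.map_matrix_volume_pi_eq_smul_volume_pi (M := g.1) (by rw [g.2]; exact one_ne_zero)
    rw [g.2, inv_one, abs_one, ENNReal.ofReal_one, one_smul] at this
    exact this

theorem det_of_mulVec (g : SLR d) (b : Fin d → Fin d → ℝ) :
    (Matrix.of fun j => g.1 *ᵥ b j).det = (Matrix.of b).det := by
  have : (Matrix.of fun j => g.1 *ᵥ b j) = (g.1 * (Matrix.of b)ᵀ)ᵀ := rfl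
  rw [this, det_transpose, det_mul, det_transpose, g.2, one_mul]

theorem isMulLeftInvariant_coneMeasure (hd : d ≠ 0) :
    (coneMeasure d).IsMulLeftInvariant := ⟨fun g => by
  ext A hA
  rw [Measure.map_apply (measurable_const_mul g) hA, coneMeasure_apply hA,
    coneMeasure_apply (measurable_const_mul g hA),
    ← (measurePreserving_mulVec g).measure_preimage
      ((measurable_normCols hA).inter measurableSet_detSet).nullMeasurableSet]
  congr 1
  ext b
  simp only [Set.mem_inter_iff, Set.mem_preimage, detSet, Set.mem_ofPred_eq, det_of_mulVec]
  refine and_congr_left fun hb => ?_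
  have : normCols (fun j => g.1 *ᵥ b j) = g * normCols b := by
    apply cols_injective
    rw [cols_normCols (by rw [det_of_mulVec]; exact hb.1) hd, det_of_mulVec]
    ext1 j
    rw [cols_mul, cols_normCols hb.1 hd, Pi.smul_apply, Pi.smul_apply, mulVec_smul]
  rw [this]⟩

theorem coneMeasure_univ_ne_zero (hd : d ≠ 0) : coneMeasure d Set.univ ≠ 0 := by
  rw [coneMeasure_apply MeasurableSet.univ, Set.preimage_univ, Set.univ_inter]
  have hopen : IsOpen {b : Fin d → Fin d → ℝ | 0 < (Matrix.of b).det ∧ (Matrix.of b).det < 1} :=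
    (isOpen_lt continuous_const continuous_det_of).inter
      (isOpen_lt continuous_det_of continuous_const)
  have hdet : (Matrix.of fun j i : Fin d => if j = i then (1 / 2 : ℝ) else 0).det =
      (1 / 2) ^ d := by
    have : (Matrix.of fun j i : Fin d => if j = i then (1 / 2 : ℝ) else 0) =
        Matrix.diagonal fun _ => 1 / 2 := by
      ext j i
      simp [Matrix.diagonal_apply]
    rw [this, det_diagonal]
    simp
  have hpos := hopen.measure_pos volume ⟨fun j i : Fin d => if j = i then (1 / 2 : ℝ) else 0, by
    simp only [Set.mem_ofPred_eq]
    rw [hdet]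
    exact ⟨by positivity, pow_lt_one₀ (by norm_num) (by norm_num) hd⟩⟩
  refine (hpos.trans_le (measure_mono ?_)).ne'
  rintro b ⟨hb1, hb2⟩
  exact ⟨hb1, hb2.le⟩

theorem det_rpow_le_one {b : Fin d → Fin d → ℝ} (hb : b ∈ detSet d) :
    0 < (Matrix.of b).det ^ (d : ℝ)⁻¹ ∧ (Matrix.of b).det ^ (d : ℝ)⁻¹ ≤ 1 :=
  ⟨Real.rpow_pos_of_pos hb.1 _, Real.rpow_le_one hb.1.le hb.2 (by positivity)⟩

theorem eq_smul_cols_normCols {b : Fin d → Fin d → ℝ} (hb : b ∈ detSet d) (hd : d ≠ 0) :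
    b = (Matrix.of b).det ^ (d : ℝ)⁻¹ • cols (normCols b) := by
  rw [cols_normCols hb.1 hd, smul_smul, mul_inv_cancel₀ (det_rpow_le_one hb).1.ne', one_smul]

theorem coneMeasure_lt_top (hd : d ≠ 0) {V : Set (SLR d)} (hV : MeasurableSet V)
    (hb : ∀ g ∈ V, ∀ i j, |g.1 i j| < 2) : coneMeasure d V < ⊤ := by
  rw [coneMeasure_apply hV]
  refine (measure_mono (t := Set.Icc (fun _ _ => -2) (fun _ _ => 2)) ?_).trans_lt
    isCompact_Icc.measure_lt_top
  rintro b ⟨h1, h2⟩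
  have key : ∀ j i, |b j i| ≤ 2 := by
    intro j i
    rw [eq_smul_cols_normCols h2 hd]
    have h3 := (hb _ h1 i j).le
    obtain ⟨h4, h5⟩ := det_rpow_le_one h2
    simp only [Pi.smul_apply, smul_eq_mul, abs_mul, abs_of_pos h4]
    calc _ ≤ 1 * 2 := mul_le_mul h5 h3 (abs_nonneg _) zero_le_one
      _ = 2 := one_mul _
  exact ⟨fun j i => (abs_le.1 (key j i)).1, fun j i => (abs_le.1 (key j i)).2⟩

/-- The lift of an invariant probability measure is a finite multiple of the cone measure. -/
theorem exists_liftMeasure_eq (hd : d ≠ 0) (μ : Measure (LatticeSpace d)) [IsProbabilityMeasure μ]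
    (hinv : ∀ (g : SLR d) (s : Set (LatticeSpace d)), μ ((g • ·) ⁻¹' s) = μ s) :
    ∃ κ : ENNReal, κ ≠ ⊤ ∧ ∀ A, liftMeasure μ A = κ * coneMeasure d A := by
  obtain ⟨V, hVo, hV1, hVb, hVs⟩ := exists_nhds_one (d := d)
  have := isMulLeftInvariant_liftMeasure hinv
  have := isMulLeftInvariant_coneMeasure hd
  have hV := hVo.measurableSet
  have hl := liftMeasure_le_one μ hV hVs
  have hc := coneMeasure_lt_top hd hV hVb
  have := sigmaFinite_of_isMulLeftInvariant _ hVo hV1 (hl.trans_lt ENNReal.one_lt_top)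
  have := sigmaFinite_of_isMulLeftInvariant _ hVo hV1 hc
  have h0 : coneMeasure d V ≠ 0 := by
    intro h
    refine coneMeasure_univ_ne_zero hd (measure_null_of_locally_null _ fun g _ =>
      ⟨(fun x => g⁻¹ * x) ⁻¹' V, mem_nhdsWithin_of_mem_nhds ?_, ?_⟩)
    · exact (hVo.preimage (continuous_const_mul g⁻¹)).mem_nhds (by simpa using hV1)
    · rwa [measure_preimage_mul]
  refine ⟨liftMeasure μ V / coneMeasure d V,
    ENNReal.div_ne_top (hl.trans_lt ENNReal.one_lt_top).ne h0, fun A => ?_⟩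
  have h1 := measure_mul_measure_eq (liftMeasure μ) (coneMeasure d) V A h0 hc.ne
  rw [ENNReal.div_eq_inv_mul, mul_assoc, h1, ← mul_assoc, ENNReal.inv_mul_cancel h0 hc.ne, one_mul]

theorem lintegral_le_volume_of_le_tsum (hd : d ≠ 0) (μ : Measure (LatticeSpace d))
    [IsProbabilityMeasure μ]
    (hinv : ∀ (g : SLR d) (s : Set (LatticeSpace d)), μ ((g • ·) ⁻¹' s) = μ s) :
    ∃ κ : ENNReal, κ ≠ ⊤ ∧ ∀ S : Set (Fin d → Fin d → ℝ), MeasurableSet S →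
      (∀ b ∈ S, ∀ s : ℝ, 0 < s → s ≤ 1 → s • b ∈ S) →
      ∫⁻ x, orbSum ((cols ⁻¹' S).indicator 1) x ∂μ ≤ κ * volume S := by
  obtain ⟨κ, hκ, H⟩ := exists_liftMeasure_eq hd μ hinv
  refine ⟨κ, hκ, fun S hS hscale => ?_⟩
  rw [← liftMeasure_apply μ (measurable_cols hS), H, coneMeasure_apply (measurable_cols hS)]
  gcongr
  rintro b ⟨h1, h2⟩
  rw [eq_smul_cols_normCols h2 hd]
  exact hscale _ h1 _ (det_rpow_le_one h2).1 (det_rpow_le_one h2).2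

end Cone

section Homogeneous

open Matrix

variable {d : ℕ}

/-- The shear `x ↦ x - x_i y°`, where `y°` is `y` with its `i`-th entry replaced by `0`. -/
def shear (i : Fin d) (y : Fin d → ℝ) : SLR d :=
  ⟨1 + replicateCol Unit (-Function.update y i 0) * replicateRow Unit (Pi.single i (1 : ℝ)), by
    rw [det_one_add_replicateCol_mul_replicateRow]; simp⟩

theorem shear_mulVec (i : Fin d) (y x : Fin d → ℝ) :
    (shear i y).1 *ᵥ x = x - x i • Function.update y i 0 := by
  ext l
  simp only [shear, Matrix.add_mulVec, one_mulVec, Pi.add_apply, Pi.sub_apply, Pi.smul_apply,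
    smul_eq_mul, sub_eq_add_neg]
  congr 1
  simp [Matrix.mulVec, dotProduct, Matrix.mul_apply, Pi.single_apply, mul_comm]

/-- The diagonal matrix with `i`-th entry `s ^ (d - 1)` and other entries `s⁻¹`. -/
def stretch (i : Fin d) {s : ℝ} (hs : s ≠ 0) : SLR d :=
  ⟨diagonal fun l => if l = i then s ^ (d - 1) else s⁻¹, by
    rw [det_diagonal, ← Finset.mul_prod_erase _ _ (Finset.mem_univ i), if_pos rfl,
      Finset.prod_congr rfl (g := fun _ => s⁻¹) fun l hl => if_neg (Finset.ne_of_mem_erase hl)]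
    rw [Finset.prod_const, Finset.card_erase_of_mem (Finset.mem_univ _), Finset.card_univ,
      Fintype.card_fin, inv_pow, mul_inv_cancel₀ (pow_ne_zero _ hs)]⟩

theorem lintegral_mulVec_eq {ν : Measure (Fin d → ℝ)}
    (hν : ∀ g : SLR d, ν.map (fun x => g.1 *ᵥ x) = ν) (g : SLR d) {f : (Fin d → ℝ) → ENNReal}
    (hf : Measurable f) : ∫⁻ x, f (g.1 *ᵥ x) ∂ν = ∫⁻ x, f x ∂ν := by
  conv_rhs => rw [← hν g]
  rw [lintegral_map hf]
  exact (Continuous.matrix_mulVec continuous_const continuous_id).measurable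

/-- The centered unit cube. -/
def unitCube (d : ℕ) : Set (Fin d → ℝ) := Set.Icc (fun _ => -(1 / 2)) (fun _ => 1 / 2)

theorem measurableSet_unitCube : MeasurableSet (unitCube d) := measurableSet_Icc

theorem volume_unitCube : volume (unitCube d) = 1 := by
  rw [unitCube, Real.volume_Icc_pi]
  norm_num

/-- The ratios `x_l / x_i`, with `i`-th entry `0`. -/
def ratios (i : Fin d) (x : Fin d → ℝ) : Fin d → ℝ := Function.update ((x i)⁻¹ • x) i 0

theorem measurable_ratios (i : Fin d) : Measurable (ratios i) := by
  refine measurable_pi_lambda _ fun l => ?_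
  by_cases h : l = i
  · subst h
    simp [ratios]
  · simp only [ratios, Function.update_of_ne h, Pi.smul_apply, smul_eq_mul]
    fun_prop

theorem lintegral_eq_lintegral_ratios {ν : Measure (Fin d → ℝ)} [SFinite ν]
    (hν : ∀ g : SLR d, ν.map (fun x => g.1 *ᵥ x) = ν) (i : Fin d) {f : (Fin d → ℝ) → ENNReal}
    (hf : Measurable f) (hf0 : ∀ x, x i = 0 → f x = 0) :
    ∫⁻ x, f x ∂ν = ∫⁻ x, (∫⁻ u, f (x i • Function.update u i 1) *
      (unitCube d).indicator 1 (ratios i x - Pi.single i (u i))) ∂ν := by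
  have hind : Measurable ((unitCube d).indicator (1 : (Fin d → ℝ) → ENNReal)) :=
    measurable_one.indicator measurableSet_unitCube
  have hupd : Measurable fun p : (Fin d → ℝ) × (Fin d → ℝ) =>
      p.1 i • Function.update p.2 i 0 := by
    refine measurable_pi_lambda _ fun l => ?_
    by_cases h : l = i
    · subst h; simp
    · simp only [Pi.smul_apply, Function.update_of_ne h, smul_eq_mul]
      fun_prop
  have hsingle : Measurable fun p : (Fin d → ℝ) × (Fin d → ℝ) =>
      (Pi.single i (p.2 i) : Fin d → ℝ) := by
    refine measurable_pi_lambda _ fun l => ?_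
    by_cases h : l = i
    · subst h; simp only [Pi.single_eq_same]; fun_prop
    · simp [h]
  have h1 : ∀ x, ∫⁻ y : Fin d → ℝ, f x * (unitCube d).indicator 1 (y + ratios i x) = f x := by
    intro x
    have hm : Measurable fun y => (unitCube d).indicator (1 : (Fin d → ℝ) → ENNReal)
        (y + ratios i x) := hind.comp (measurable_add_const _)
    rw [lintegral_const_mul _ hm,
      lintegral_add_right_eq_self (μ := volume) ((unitCube d).indicator 1) (ratios i x),
      lintegral_indicator_one measurableSet_unitCube, volume_unitCube, mul_one]
  calc ∫⁻ x, f x ∂ν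
      = ∫⁻ x, (∫⁻ y : Fin d → ℝ, f x * (unitCube d).indicator 1 (y + ratios i x)) ∂ν := by
        simp_rw [h1]
    _ = ∫⁻ y : Fin d → ℝ, (∫⁻ x, f x * (unitCube d).indicator 1 (y + ratios i x) ∂ν) := by
        refine lintegral_lintegral_swap (Measurable.aemeasurable ?_)
        exact (hf.comp measurable_fst).mul (hind.comp
          (measurable_snd.add ((measurable_ratios i).comp measurable_fst)))
    _ = ∫⁻ y : Fin d → ℝ, (∫⁻ x, f (x - x i • Function.update y i 0) *
          (unitCube d).indicator 1 (ratios i x + Pi.single i (y i)) ∂ν) := by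
        refine lintegral_congr fun y => ?_
        rw [← lintegral_mulVec_eq hν (shear i y)]
        · refine lintegral_congr fun x => ?_
          rw [shear_mulVec]
          by_cases hx : x i = 0
          · simp [hx, hf0]
          · congr 2
            ext l
            by_cases h : l = i
            · subst h; simp [ratios]
            · simp only [ratios, Pi.add_apply, Function.update_of_ne h, Pi.smul_apply,
                Pi.sub_apply, Function.update_self, smul_eq_mul, mul_zero, sub_zero,
                Pi.single_eq_of_ne h]
              field_simp
              ring
        · exact hf.mul (hind.comp ((measurable_ratios i).const_add y))
    _ = ∫⁻ x, (∫⁻ y : Fin d → ℝ, f (x - x i • Function.update y i 0) *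
          (unitCube d).indicator 1 (ratios i x + Pi.single i (y i))) ∂ν := by
        refine (lintegral_lintegral_swap (Measurable.aemeasurable ?_)).symm
        exact (hf.comp (measurable_fst.sub hupd)).mul (hind.comp
          (((measurable_ratios i).comp measurable_fst).add hsingle))
    _ = _ := by
        refine lintegral_congr fun x => ?_
        rw [← lintegral_sub_left_eq_self (μ := volume) _ (ratios i x)]
        refine lintegral_congr fun u => ?_
        by_cases hx : x i = 0
        · rw [hf0 _ (by simp [hx]), hf0 _ (by simp [hx])]
          simp
        · congr 2
          · ext l
            by_cases h : l = i
            · subst h; simp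
            · simp only [ratios, Function.update_of_ne h, Pi.smul_apply,
                Pi.sub_apply, smul_eq_mul]
              field_simp
              ring
          · ext l
            by_cases h : l = i
            · subst h; simp [ratios]
            · simp [h]

theorem lintegral_eq_pow_mul_lintegral_smul {ν : Measure (Fin d → ℝ)} [SFinite ν]
    (hν : ∀ g : SLR d, ν.map (fun x => g.1 *ᵥ x) = ν) (i : Fin d) {f : (Fin d → ℝ) → ENNReal}
    (hf : Measurable f) (hf0 : ∀ x, x i = 0 → f x = 0) {s : ℝ} (hs : 0 < s) :
    ∫⁻ x, f x ∂ν = ENNReal.ofReal (s ^ (d - 1)) ^ d * ∫⁻ x, f (s ^ (d - 1) • x) ∂ν := by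
  have hmv : Measurable fun x : Fin d → ℝ => (stretch i hs.ne').1 *ᵥ x :=
    (Continuous.matrix_mulVec continuous_const continuous_id).measurable
  have hst : ∀ x l, ((stretch i hs.ne').1 *ᵥ x) l = (if l = i then s ^ (d - 1) else s⁻¹) * x l := by
    intro x l
    simp [stretch, mulVec_diagonal]
  have hd1 : d - 1 + 1 = d := Nat.sub_add_cancel (i.pos)
  rw [← lintegral_mulVec_eq hν (stretch i hs.ne') hf,
    lintegral_eq_lintegral_ratios hν i (f := fun x => f ((stretch i hs.ne').1 *ᵥ x)) (hf.comp hmv)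
      fun x hx => hf0 _ (by rw [hst, hx, mul_zero]),
    lintegral_eq_lintegral_ratios hν i (f := fun x => f (s ^ (d - 1) • x))
      (hf.comp (measurable_const_smul _)) fun x hx => hf0 _ (by simp [hx]),
    ← lintegral_const_mul' _ _ (by finiteness)]
  refine lintegral_congr fun x => ?_
  set h : (Fin d → ℝ) → ENNReal := fun u => f (s ^ (d - 1) • x i • Function.update u i 1) *
      (unitCube d).indicator 1 (ratios i x - Pi.single i (u i)) with hh
  set D : Matrix (Fin d) (Fin d) ℝ := diagonal fun l => if l = i then 1 else (s ^ d)⁻¹ with hD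
  have hDapp : ∀ u l, (D *ᵥ u) l = (if l = i then 1 else (s ^ d)⁻¹) * u l := by
    intro u l
    simp [hD, mulVec_diagonal]
  have hDdet : D.det = (s ^ (d * (d - 1)))⁻¹ := by
    rw [det_diagonal, ← Finset.mul_prod_erase _ _ (Finset.mem_univ i), if_pos rfl,
      Finset.prod_congr rfl (g := fun _ => (s ^ d)⁻¹) fun l hl =>
        if_neg (Finset.ne_of_mem_erase hl)]
    rw [Finset.prod_const, Finset.card_erase_of_mem (Finset.mem_univ _), Finset.card_univ,
      Fintype.card_fin, inv_pow, ← pow_mul, one_mul]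
  have hDmeas : Measurable fun u : Fin d → ℝ => D *ᵥ u :=
    (Continuous.matrix_mulVec continuous_const continuous_id).measurable
  have hhmeas : Measurable h := by
    refine Measurable.mul (hf.comp ?_) ((measurable_one.indicator measurableSet_unitCube).comp ?_)
    · refine measurable_pi_lambda _ fun l => ?_
      by_cases hl : l = i
      · subst hl; simp
      · simp only [Pi.smul_apply, Function.update_of_ne hl, smul_eq_mul]
        fun_prop
    · refine measurable_pi_lambda _ fun l => ?_
      by_cases hl : l = i
      · subst hl; simp only [Pi.sub_apply, Pi.single_eq_same]; fun_prop
      · simp [hl]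
  have hmap := Real.map_matrix_volume_pi_eq_smul_volume_pi (M := D)
    (by rw [hDdet]; positivity)
  have hint : ∫⁻ u, h (D *ᵥ u) = ENNReal.ofReal (s ^ (d - 1)) ^ d * ∫⁻ u, h u := by
    have h2 := lintegral_map (μ := volume) hhmeas hDmeas
    rw [← h2]
    change ∫⁻ u, h u ∂(volume.map (Matrix.toLin' D)) = _
    rw [hmap, lintegral_smul_measure, hDdet, inv_inv, abs_of_pos (by positivity),
      ← ENNReal.ofReal_pow (by positivity), ← pow_mul, mul_comm d, smul_eq_mul]
  rw [← hint]
  refine lintegral_congr fun u => ?_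
  simp only [hh]
  have e1 : (D *ᵥ u) i = u i := by rw [hDapp]; simp
  rw [e1]
  congr 2
  ext l
  rw [hst]
  by_cases hl : l = i
  · subst hl; simp
  · simp only [hl, if_false, Pi.smul_apply, Function.update_of_ne hl, hDapp, smul_eq_mul]
    have : s ^ d = s ^ (d - 1) * s := by rw [← pow_succ, hd1]
    rw [this]
    field_simp

/-- The nonzero vectors whose first nonzero entry is in position `i`. -/
def firstNonzero (i : Fin d) : Set (Fin d → ℝ) := {x | x i ≠ 0 ∧ ∀ l < i, x l = 0}

theorem measurableSet_firstNonzero (i : Fin d) : MeasurableSet (firstNonzero i) := by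
  have : firstNonzero i = {x | x i ≠ 0} ∩ ⋂ l, ⋂ _ : l < i, {x | x l = 0} := by
    ext x; simp [firstNonzero]
  rw [this]
  refine MeasurableSet.inter (measurable_pi_apply i (measurableSet_singleton 0).compl) ?_
  exact MeasurableSet.iInter fun l => MeasurableSet.iInter fun _ =>
    measurable_pi_apply l (measurableSet_singleton 0)

theorem pairwise_disjoint_firstNonzero :
    Pairwise (Function.onFun Disjoint (firstNonzero (d := d))) := by
  intro i j hij
  refine Set.disjoint_left.2 fun x hi hj => ?_
  rcases lt_or_gt_of_ne hij with h | h
  · exact hi.1 (hj.2 i h)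
  · exact hj.1 (hi.2 j h)

theorem iUnion_firstNonzero : ⋃ i, firstNonzero (d := d) i = {0}ᶜ := by
  ext x
  simp only [Set.mem_iUnion, Set.mem_compl_iff, Set.mem_singleton_iff]
  constructor
  · rintro ⟨i, hi, -⟩ rfl
    exact hi rfl
  · intro hx
    obtain ⟨i, hi⟩ := Function.ne_iff.1 hx
    have hne : (Finset.univ.filter fun l => x l ≠ 0).Nonempty := ⟨i, by simpa using hi⟩
    refine ⟨_, (Finset.mem_filter.1 (Finset.min'_mem _ hne)).2, fun l hl => ?_⟩
    by_contra h
    exact absurd (Finset.min'_le _ l (by simpa using h)) hl.not_ge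

theorem measure_eq_sum_firstNonzero {ν : Measure (Fin d → ℝ)} (hν0 : ν {0} = 0)
    (A : Set (Fin d → ℝ)) : ν A = ∑ i, ν (A ∩ firstNonzero i) := by
  have h1 : ν A = ν (A ∩ ⋃ i, firstNonzero i) := by
    rw [iUnion_firstNonzero, ← Set.sdiff_eq_compl_inter.trans (Set.inter_comm _ _)]
    exact (measure_sdiff_null hν0).symm
  rw [h1, ← Measure.restrict_apply' (MeasurableSet.iUnion measurableSet_firstNonzero),
    Measure.restrict_iUnion pairwise_disjoint_firstNonzero measurableSet_firstNonzero,
    Measure.sum_fintype, Measure.finsetSum_apply]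
  exact Finset.sum_congr rfl fun i _ => Measure.restrict_apply' (measurableSet_firstNonzero i)

/-- An `SL_d(ℝ)`-invariant measure is homogeneous of degree `d`. -/
theorem measure_euclBall_eq (hd : 2 ≤ d) {ν : Measure (Fin d → ℝ)} [SFinite ν]
    (hν : ∀ g : SLR d, ν.map (fun x => g.1 *ᵥ x) = ν) (hν0 : ν {0} = 0) {r : ℝ} (hr : 0 < r) :
    ν (euclBall d r) = ENNReal.ofReal r ^ d * ν (euclBall d 1) := by
  rw [measure_eq_sum_firstNonzero hν0 (euclBall d r),
    measure_eq_sum_firstNonzero hν0 (euclBall d 1),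
    Finset.mul_sum]
  refine Finset.sum_congr rfl fun i _ => ?_
  set s : ℝ := r ^ ((d - 1 : ℕ) : ℝ)⁻¹
  have hs : 0 < s := Real.rpow_pos_of_pos hr _
  have hsr : s ^ (d - 1) = r := Real.rpow_inv_natCast_pow hr.le (by omega)
  have hm : ∀ r, MeasurableSet (euclBall d r ∩ firstNonzero i) := fun r =>
    (measurableSet_euclBall r).inter (measurableSet_firstNonzero i)
  have key := lintegral_eq_pow_mul_lintegral_smul hν i
    (f := (euclBall d r ∩ firstNonzero i).indicator 1) (measurable_one.indicator (hm r))
    (fun x hx => Set.indicator_of_notMem (fun h => h.2.1 hx) _) hs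
  rw [lintegral_indicator_one (hm r), hsr] at key
  rw [key, ← lintegral_indicator_one (hm 1)]
  congr 1
  refine lintegral_congr fun x => ?_
  have : r • x ∈ euclBall d r ∩ firstNonzero i ↔ x ∈ euclBall d 1 ∩ firstNonzero i := by
    simp only [Set.mem_inter_iff, mem_euclBall, firstNonzero, Set.mem_ofPred_eq, Pi.smul_apply,
      smul_eq_mul, mul_eq_zero, hr.ne', false_or, WithLp.toLp_smul, norm_smul,
      Real.norm_of_nonneg hr.le, ne_eq]
    rw [mul_lt_iff_lt_one_right hr]
  by_cases h : x ∈ euclBall d 1 ∩ firstNonzero i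
  · rw [Set.indicator_of_mem h, Set.indicator_of_mem (this.2 h)]; rfl
  · rw [Set.indicator_of_notMem h, Set.indicator_of_notMem (mt this.1 h)]

end Homogeneous

section VecSum

open Matrix

variable {d : ℕ}

/-- An integer vector as a real vector. -/
def toV (v : Fin d → ℤ) : Fin d → ℝ := fun i => v i

theorem toV_mulVec (γ : Matrix.SpecialLinearGroup (Fin d) ℤ) (v : Fin d → ℤ) :
    toV (γ.1 *ᵥ v) = (toR γ).1 *ᵥ toV v := by
  ext i
  simp [toV, Matrix.mulVec, dotProduct, toR_apply]

theorem toV_smul (n : ℤ) (v : Fin d → ℤ) : toV (n • v) = (n : ℝ) • toV v := by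
  ext i
  simp [toV]

/-- The action of `SL_d(ℤ)` on `ℤ^d`. -/
def mulVecEquiv (γ : Matrix.SpecialLinearGroup (Fin d) ℤ) : (Fin d → ℤ) ≃ (Fin d → ℤ) where
  toFun v := γ.1 *ᵥ v
  invFun v := (γ⁻¹).1 *ᵥ v
  left_inv v := by
    have : (γ⁻¹).1 * γ.1 = 1 := congrArg Subtype.val (inv_mul_cancel γ)
    simp only [mulVec_mulVec, this, one_mulVec]
  right_inv v := by
    have : γ.1 * (γ⁻¹).1 = 1 := congrArg Subtype.val (mul_inv_cancel γ)
    simp only [mulVec_mulVec, this, one_mulVec]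

/-- The weighted sum of a function over the vectors of a lattice. -/
def vecSum (w : (Fin d → ℤ) → ENNReal) (f : (Fin d → ℝ) → ENNReal) (x : LatticeSpace d) : ENNReal :=
  ∑' v : Fin d → ℤ, w v * f (x.out.1 *ᵥ toV v)

/-- A weight on `ℤ^d` is `SL_d(ℤ)`-invariant. -/
def IsInvWeight (w : (Fin d → ℤ) → ENNReal) : Prop :=
  ∀ (γ : Matrix.SpecialLinearGroup (Fin d) ℤ) (v : Fin d → ℤ), w (γ.1 *ᵥ v) = w v

variable {w : (Fin d → ℤ) → ENNReal}

theorem vecSum_mk (hw : IsInvWeight w) (f : (Fin d → ℝ) → ENNReal) (g : SLR d) :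
    vecSum w f (QuotientGroup.mk g) = ∑' v : Fin d → ℤ, w v * f (g.1 *ᵥ toV v) := by
  obtain ⟨⟨h, γ₀, rfl⟩, hh⟩ := QuotientGroup.mk_out_eq_mul (SLZ d) g
  rw [vecSum, hh, ← (mulVecEquiv γ₀).tsum_eq fun v => w v * f (g.1 *ᵥ toV v)]
  refine tsum_congr fun v => ?_
  have h1 : mulVecEquiv γ₀ v = γ₀.1 *ᵥ v := rfl
  rw [h1, hw, toV_mulVec, mulVec_mulVec]
  rfl

theorem measurable_mulVec_left (x : Fin d → ℝ) : Measurable fun g : SLR d => g.1 *ᵥ x :=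
  have : Continuous fun g : SLR d => g.1 *ᵥ x :=
    Continuous.matrix_mulVec continuous_subtype_val continuous_const
  this.measurable

theorem measurable_vecSum (hw : IsInvWeight w) {f : (Fin d → ℝ) → ENNReal} (hf : Measurable f) :
    Measurable (vecSum w f) := by
  refine QuotientGroup.measurable_from_quotient.2 ?_
  have : vecSum w f ∘ ((↑) : SLR d → LatticeSpace d) = fun g => ∑' v, w v * f (g.1 *ᵥ toV v) :=
    funext fun g => vecSum_mk hw f g
  rw [this]
  exact Measurable.tsum fun v => (hf.comp (measurable_mulVec_left _)).const_mul _

/-- The mean weighted number of lattice vectors in a set. -/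
def vecMeasure (hw : IsInvWeight w) (μ : Measure (LatticeSpace d)) : Measure (Fin d → ℝ) :=
  Measure.ofMeasurable (fun A _ => ∫⁻ x, vecSum w (A.indicator 1) x ∂μ) (by simp [vecSum]) (by
    intro A hA hd
    rw [← lintegral_tsum fun i =>
      (measurable_vecSum hw (measurable_one.indicator (hA i))).aemeasurable]
    refine lintegral_congr fun x => ?_
    simp only [vecSum]
    rw [ENNReal.tsum_comm]
    refine tsum_congr fun v => ?_
    rw [ENNReal.tsum_mul_left]
    congr 1
    have := measure_iUnion (μ := Measure.dirac (x.out.1 *ᵥ toV v)) hd hA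
    rw [Measure.dirac_apply' _ (MeasurableSet.iUnion hA)] at this
    exact this.trans (tsum_congr fun i => Measure.dirac_apply' _ (hA i)))

theorem vecMeasure_apply (hw : IsInvWeight w) (μ : Measure (LatticeSpace d)) {A : Set (Fin d → ℝ)}
    (hA : MeasurableSet A) : vecMeasure hw μ A = ∫⁻ x, vecSum w (A.indicator 1) x ∂μ :=
  Measure.ofMeasurable_apply _ hA

theorem map_vecMeasure (hw : IsInvWeight w) {μ : Measure (LatticeSpace d)}
    (hinv : ∀ (g : SLR d) (s : Set (LatticeSpace d)), μ ((g • ·) ⁻¹' s) = μ s) (g : SLR d) :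
    (vecMeasure hw μ).map (fun x => g.1 *ᵥ x) = vecMeasure hw μ := by
  have hm : Measurable fun x : Fin d → ℝ => g.1 *ᵥ x :=
    (Continuous.matrix_mulVec continuous_const continuous_id).measurable
  ext A hA
  rw [Measure.map_apply hm hA, vecMeasure_apply hw μ hA, vecMeasure_apply hw μ (hm hA),
    ← lintegral_smul_latticeSpace hinv g (measurable_vecSum hw (measurable_one.indicator hA))]
  refine lintegral_congr fun x => ?_
  induction x using QuotientGroup.induction_on with
  | H h =>
    have : g • (QuotientGroup.mk h : LatticeSpace d) = QuotientGroup.mk (g * h) := rfl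
    rw [this, vecSum_mk hw, vecSum_mk hw]
    refine tsum_congr fun v => ?_
    have h2 : (g * h).1 *ᵥ toV v = g.1 *ᵥ (h.1 *ᵥ toV v) := by
      rw [mulVec_mulVec]; rfl
    rw [h2]
    rfl

theorem mulVec_toV_eq_zero {g : SLR d} {v : Fin d → ℤ} : g.1 *ᵥ toV v = 0 ↔ v = 0 := by
  constructor
  · intro h
    have h1 : (g⁻¹).1 * g.1 = 1 := congrArg Subtype.val (inv_mul_cancel g)
    have h2 : toV v = 0 := by
      rw [← one_mulVec (toV v), ← h1, ← mulVec_mulVec, h, mulVec_zero]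
    ext i
    have := congrFun h2 i
    simpa [toV] using this
  · rintro rfl
    have : toV (0 : Fin d → ℤ) = 0 := by ext; simp [toV]
    rw [this, mulVec_zero]

theorem vecMeasure_singleton_zero (hw : IsInvWeight w) (hw0 : w 0 = 0)
    (μ : Measure (LatticeSpace d)) : vecMeasure hw μ {0} = 0 := by
  rw [vecMeasure_apply hw μ (measurableSet_singleton 0)]
  have : ∀ x, vecSum w (({0} : Set (Fin d → ℝ)).indicator 1) x = 0 := by
    intro x
    refine ENNReal.tsum_eq_zero.2 fun v => ?_
    by_cases h : v = 0
    · rw [h, hw0, zero_mul]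
    · have h1 : x.out.1 *ᵥ toV v ∉ ({0} : Set (Fin d → ℝ)) := fun h' =>
        h (mulVec_toV_eq_zero.1 h')
      rw [Set.indicator_of_notMem h1, mul_zero]
  rw [lintegral_congr this, lintegral_zero]

end VecSum

section Primitive

open Matrix

variable {d : ℕ} [NeZero d]

/-- The primitive integer vectors. -/
def Prim (d : ℕ) [NeZero d] : Set (Fin d → ℤ) :=
  Set.range fun γ : Matrix.SpecialLinearGroup (Fin d) ℤ => γ.1 *ᵥ Pi.single 0 1

theorem mulVec_mem_Prim (γ : Matrix.SpecialLinearGroup (Fin d) ℤ) {v : Fin d → ℤ} :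
    γ.1 *ᵥ v ∈ Prim d ↔ v ∈ Prim d := by
  constructor
  · rintro ⟨γ', h⟩
    refine ⟨γ⁻¹ * γ', ?_⟩
    have h' : γ'.1 *ᵥ Pi.single 0 1 = γ.1 *ᵥ v := h
    have h1 : (γ⁻¹).1 * γ.1 = 1 := congrArg Subtype.val (inv_mul_cancel γ)
    change ((γ⁻¹).1 * γ'.1) *ᵥ Pi.single 0 1 = v
    rw [← mulVec_mulVec, h', mulVec_mulVec, h1, one_mulVec]
  · rintro ⟨γ', rfl⟩
    exact ⟨γ * γ', (mulVec_mulVec _ _ _).symm⟩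

theorem isInvWeight_Prim : IsInvWeight ((Prim d).indicator 1) := by
  intro γ v
  by_cases h : v ∈ Prim d
  · rw [Set.indicator_of_mem h, Set.indicator_of_mem ((mulVec_mem_Prim γ).2 h)]; rfl
  · rw [Set.indicator_of_notMem h, Set.indicator_of_notMem (mt (mulVec_mem_Prim γ).1 h)]

theorem ne_zero_of_mem_Prim {v : Fin d → ℤ} (hv : v ∈ Prim d) : v ≠ 0 := by
  obtain ⟨γ, rfl⟩ := hv
  intro h
  have : mulVecEquiv γ (Pi.single 0 1) = mulVecEquiv γ 0 := h.trans (mulVec_zero γ.1).symm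
  have := congrFun ((mulVecEquiv γ).injective this) 0
  simp at this

theorem mulVec_single_zero (γ : Matrix.SpecialLinearGroup (Fin d) ℤ) (l : Fin d) :
    (γ.1 *ᵥ Pi.single 0 1) l = γ.1 l 0 := by
  simp

/-- A primitive vector is divisible by units only. -/
theorem isUnit_of_smul_mem_Prim {n : ℤ} {v : Fin d → ℤ} (h : n • v ∈ Prim d) : IsUnit n := by
  obtain ⟨γ, hγ⟩ := h
  have hγ' : γ.1 *ᵥ Pi.single 0 1 = n • v := hγ
  have h1 : (γ⁻¹).1 * γ.1 = 1 := congrArg Subtype.val (inv_mul_cancel γ)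
  have h2 : (Pi.single 0 1 : Fin d → ℤ) = n • ((γ⁻¹).1 *ᵥ v) := by
    rw [← mulVec_smul, ← hγ', mulVec_mulVec, h1, one_mulVec]
  have := congrFun h2 0
  simp only [Pi.single_eq_same, Pi.smul_apply, smul_eq_mul] at this
  exact IsUnit.of_mul_eq_one _ this.symm

theorem neg_mem_Prim (hd : 2 ≤ d) {v : Fin d → ℤ} (hv : v ∈ Prim d) : -v ∈ Prim d := by
  obtain ⟨γ, rfl⟩ := hv
  have hne : (⟨1, hd⟩ : Fin d) ≠ 0 := by
    intro h; have := congrArg Fin.val h; simp at this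
  set δ : Matrix.SpecialLinearGroup (Fin d) ℤ :=
    ⟨diagonal fun i => if i = 0 ∨ i = ⟨1, hd⟩ then -1 else 1, by
      rw [det_diagonal, Finset.prod_ite, Finset.prod_const, Finset.prod_const_one, mul_one]
      have : (Finset.univ.filter fun i : Fin d => i = 0 ∨ i = ⟨1, hd⟩) = {0, ⟨1, hd⟩} := by
        ext; simp
      rw [this, Finset.card_pair hne.symm]
      norm_num⟩
  refine ⟨γ * δ, ?_⟩
  have h1 : δ.1 *ᵥ Pi.single 0 1 = -Pi.single 0 1 := by
    ext i
    by_cases hi : i = 0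
    · subst hi; simp [δ]
    · simp [δ, hi]
  change (γ.1 * δ.1) *ᵥ Pi.single 0 1 = _
  rw [← mulVec_mulVec, h1, mulVec_neg]

theorem exists_eq_smul_Prim (hd : 2 ≤ d) {v : Fin d → ℤ} (hv : v ≠ 0) :
    ∃ n : ℕ+, ∃ p ∈ Prim d, v = ((n : ℕ) : ℤ) • p := by
  obtain ⟨i, hi⟩ := Function.ne_iff.1 hv
  obtain ⟨n, hn, H⟩ := exists_fixesFirst_column 0 v ⟨i, Fin.zero_le _, hi⟩
  obtain ⟨γ, -, θ, hθ, -, hγ⟩ := H 0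
  have hp : γ.1 *ᵥ Pi.single 0 1 ∈ Prim d := ⟨γ, rfl⟩
  have hvn : v = n • (γ.1 *ᵥ Pi.single 0 1) := by
    ext l
    have h1 := hγ l
    rw [hθ l (Fin.zero_le _), add_zero, eq_div_iff (by exact_mod_cast hn)] at h1
    rw [Pi.smul_apply, mulVec_single_zero, smul_eq_mul, mul_comm]
    exact_mod_cast h1.symm
  rcases lt_or_gt_of_ne hn with h | h
  · refine ⟨⟨n.natAbs, Int.natAbs_pos.2 hn⟩, _, neg_mem_Prim hd hp, ?_⟩
    rw [PNat.mk_coe, Int.ofNat_natAbs_of_nonpos h.le, neg_smul_neg]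
    exact hvn
  · refine ⟨⟨n.natAbs, Int.natAbs_pos.2 hn⟩, _, hp, ?_⟩
    rw [PNat.mk_coe, Int.natAbs_of_nonneg h.le]
    exact hvn

theorem bijective_smul_Prim (hd : 2 ≤ d) : Function.Bijective
    fun q : ℕ+ × Prim d => (⟨((q.1 : ℕ) : ℤ) • q.2.1, smul_ne_zero
      (by exact_mod_cast q.1.ne_zero) (ne_zero_of_mem_Prim q.2.2)⟩ : {v : Fin d → ℤ // v ≠ 0}) := by
  have hdvd : ∀ (n m : ℕ+) (p : Prim d) (q : Fin d → ℤ), ((n : ℕ) : ℤ) • q = ((m : ℕ) : ℤ) • p.1 →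
      (n : ℕ) ∣ m := by
    rintro n m ⟨_, γ, rfl⟩ q h
    have h1 : (γ⁻¹).1 * γ.1 = 1 := congrArg Subtype.val (inv_mul_cancel γ)
    have h2 := congrFun (congrArg (fun x => (γ⁻¹).1 *ᵥ x) h) 0
    simp only [mulVec_smul, mulVec_mulVec, h1, one_mulVec, Pi.smul_apply, Pi.single_eq_same,
      smul_eq_mul, mul_one] at h2
    exact Int.natCast_dvd_natCast.1 ⟨_, h2.symm⟩
  constructor
  · rintro ⟨n, p⟩ ⟨m, q⟩ h
    have h' : ((n : ℕ) : ℤ) • p.1 = ((m : ℕ) : ℤ) • q.1 := congrArg Subtype.val h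
    have hnm : n = m :=
      PNat.coe_injective (Nat.dvd_antisymm (hdvd _ _ _ _ h') (hdvd _ _ _ _ h'.symm))
    subst hnm
    have := smul_right_injective (Fin d → ℤ) (r := ((n : ℕ) : ℤ)) (by exact_mod_cast n.ne_zero) h'
    rw [Subtype.ext this]
  · rintro ⟨v, hv⟩
    obtain ⟨n, p, hp, h⟩ := exists_eq_smul_Prim hd hv
    exact ⟨(n, ⟨p, hp⟩), Subtype.ext h.symm⟩

end Primitive

section Counting

open Matrix

variable {d : ℕ}

theorem toLp_smul_mem_euclBall {r s : ℝ} (hs : 0 < s) {x : Fin d → ℝ} :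
    s • x ∈ euclBall d r ↔ x ∈ euclBall d (r / s) := by
  rw [mem_euclBall, mem_euclBall, WithLp.toLp_smul, norm_smul, Real.norm_of_nonneg hs.le,
    lt_div_iff₀' hs]

theorem exists_norm_le_mulVec (g : SLR d) :
    ∃ M > 0, ∀ x : Fin d → ℝ, ‖WithLp.toLp 2 x‖ ≤ M * ‖WithLp.toLp 2 (g.1 *ᵥ x)‖ := by
  set T := Matrix.toEuclideanCLM (n := Fin d) (𝕜 := ℝ) (g⁻¹).1
  refine ⟨‖T‖ + 1, by positivity, fun x => ?_⟩
  have h1 : (g⁻¹).1 * g.1 = 1 := congrArg Subtype.val (inv_mul_cancel g)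
  have h2 : T (WithLp.toLp 2 (g.1 *ᵥ x)) = WithLp.toLp 2 x := by
    rw [Matrix.toEuclideanCLM_toLp, mulVec_mulVec, h1, one_mulVec]
  rw [← h2]
  refine (T.le_opNorm _).trans ?_
  gcongr
  linarith

theorem abs_le_norm_toV (v : Fin d → ℤ) (i : Fin d) : |(v i : ℝ)| ≤ ‖WithLp.toLp 2 (toV v)‖ :=
  PiLp.norm_apply_le (WithLp.toLp 2 (toV v)) i

theorem one_le_norm_toV {v : Fin d → ℤ} (hv : v ≠ 0) : 1 ≤ ‖WithLp.toLp 2 (toV v)‖ := by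
  obtain ⟨i, hi⟩ := Function.ne_iff.1 hv
  refine le_trans ?_ (abs_le_norm_toV v i)
  exact_mod_cast Int.one_le_abs hi

theorem finite_setOf_mulVec_mem_euclBall (g : SLR d) (r : ℝ) :
    {v : Fin d → ℤ | g.1 *ᵥ toV v ∈ euclBall d r}.Finite := by
  obtain ⟨M, hM, H⟩ := exists_norm_le_mulVec g
  refine (Set.finite_Icc (fun _ : Fin d => -⌈M * r⌉) (fun _ => ⌈M * r⌉)).subset fun v hv => ?_
  have key : ∀ i, |v i| ≤ ⌈M * r⌉ := by
    intro i
    have h1 : ‖WithLp.toLp 2 (g.1 *ᵥ toV v)‖ < r := hv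
    have h2 : |(v i : ℝ)| ≤ M * r := (abs_le_norm_toV v i).trans ((H _).trans (by gcongr))
    have h3 := h2.trans (Int.le_ceil _)
    exact_mod_cast h3
  exact ⟨fun i => (abs_le.1 (key i)).1, fun i => (abs_le.1 (key i)).2⟩

theorem measurePreserving_mulVec_single (g : SLR d) :
    MeasurePreserving (fun x : Fin d → ℝ => g.1 *ᵥ x) volume volume := by
  refine ⟨(Continuous.matrix_mulVec continuous_const continuous_id).measurable, ?_⟩
  have := Real.map_matrix_volume_pi_eq_smul_volume_pi (M := g.1) (by rw [g.2]; exact one_ne_zero)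
  rw [g.2, inv_one, abs_one, ENNReal.ofReal_one, one_smul] at this
  exact this

theorem tendsto_card_mulVec_mem_euclBall (g : SLR d) :
    Filter.Tendsto
      (fun n : ℕ => (Nat.card {v : Fin d → ℤ | g.1 *ᵥ toV v ∈ euclBall d n} : ℝ) / n ^ d)
      Filter.atTop (nhds (volume.real (euclBall d 1))) := by
  set s : Set (Fin d → ℝ) := {x | g.1 *ᵥ x ∈ euclBall d 1} with hs
  have hlin : s = ((WithLp.linearEquiv 2 ℝ (Fin d → ℝ)).symm.toLinearMap ∘ₗ g.1.mulVecLin) ⁻¹'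
      Metric.ball 0 1 := by
    ext x
    simp [hs, mem_euclBall]
  have hconv : Convex ℝ s := by
    rw [hlin]
    exact (convex_ball _ _).linear_preimage _
  have hmeas : MeasurableSet s :=
    (measurePreserving_mulVec_single g).measurable (measurableSet_euclBall 1)
  have hvol : volume.real s = volume.real (euclBall d 1) := by
    rw [measureReal_def, measureReal_def, ← (measurePreserving_mulVec_single g).measure_preimage
      (measurableSet_euclBall 1).nullMeasurableSet]
    rfl
  have hbdd : Bornology.IsBounded s := by
    obtain ⟨M, hM, H⟩ := exists_norm_le_mulVec g
    refine isBounded_iff_forall_norm_le.2 ⟨M, fun x hx => ?_⟩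
    refine (pi_norm_le_iff_of_nonneg hM.le).2 fun i => ?_
    refine (PiLp.norm_apply_le (WithLp.toLp 2 x) i).trans ((H x).trans ?_)
    have : ‖WithLp.toLp 2 (g.1 *ᵥ x)‖ < 1 := hx
    nlinarith
  have := tendsto_card_div_pow_atTop_volume s hbdd hmeas (hconv.addHaar_frontier _)
  rw [hvol, Fintype.card_fin] at this
  refine this.congr' ?_
  filter_upwards [Filter.eventually_gt_atTop 0] with n hn
  have hn' : (0 : ℝ) < n := by exact_mod_cast hn
  congr 2
  have hinj : Function.Injective fun v : Fin d → ℤ => (n : ℝ)⁻¹ • toV v := by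
    intro v w h
    have h1 := smul_right_injective (Fin d → ℝ) (r := (n : ℝ)⁻¹) (by positivity) h
    ext i
    have := congrFun h1 i
    simpa [toV] using this
  rw [← Nat.card_image_of_injective hinj]
  congr 2
  ext x
  simp only [Set.mem_inter_iff, Set.mem_inv_smul_set_iff₀ hn'.ne', SetLike.mem_coe,
    Module.Basis.mem_span_iff_repr_mem, Pi.basisFun_repr, Set.mem_image]
  constructor
  · rintro ⟨h1, h2⟩
    choose v hv using h2
    have hx : (n : ℝ) • x = toV v := funext fun i => by simpa [toV] using (hv i).symm
    refine ⟨v, ?_, by rw [← hx, inv_smul_smul₀ hn'.ne']⟩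
    rw [Set.mem_ofPred_eq, ← hx, mulVec_smul, toLp_smul_mem_euclBall hn', div_self hn'.ne']
    exact h1
  · rintro ⟨v, hv, rfl⟩
    refine ⟨?_, fun i => ⟨v i, by simp [toV, hn'.ne']⟩⟩
    rw [hs, Set.mem_ofPred_eq, mulVec_smul, toLp_smul_mem_euclBall (by positivity)]
    simpa using hv

theorem tsum_indicator_mulVec_eq_card (g : SLR d) (r : ℝ) :
    ∑' v : Fin d → ℤ, (euclBall d r).indicator (1 : (Fin d → ℝ) → ENNReal) (g.1 *ᵥ toV v) =
      ENNReal.ofReal (Nat.card {v : Fin d → ℤ | g.1 *ᵥ toV v ∈ euclBall d r}) := by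
  have hfin := finite_setOf_mulVec_mem_euclBall g r
  set A := {v : Fin d → ℤ | g.1 *ᵥ toV v ∈ euclBall d r}
  have h1 : ∑' v : Fin d → ℤ, (euclBall d r).indicator (1 : (Fin d → ℝ) → ENNReal) (g.1 *ᵥ toV v) =
      ∑' v, A.indicator (fun _ => 1) v := rfl
  rw [h1, ← tsum_subtype, ENNReal.tsum_set_one, ENNReal.ofReal_natCast, Nat.card_coe_set_eq,
    ← hfin.cast_ncard_eq]
  rfl

theorem tsum_indicator_mulVec_le (g : SLR d) {n : ℕ} (hn : n ≠ 0) :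
    ∑' v : Fin d → ℤ, (euclBall d n).indicator (1 : (Fin d → ℝ) → ENNReal) (g.1 *ᵥ toV v) ≤
      (2 * n : ENNReal) ^ d *
        ∑' v : Fin d → ℤ, (euclBall d 1).indicator (1 : (Fin d → ℝ) → ENNReal) (g.1 *ᵥ toV v) := by
  have : NeZero (2 * n) := ⟨by omega⟩
  have hn' : (0 : ℝ) < n := by positivity
  set T := ∑' v : Fin d → ℤ, (euclBall d 1).indicator (1 : (Fin d → ℝ) → ENNReal) (g.1 *ᵥ toV v)
  let cls : (Fin d → ℤ) → Fin d → ZMod (2 * n) := fun v i => (v i : ZMod (2 * n))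
  rw [← (Equiv.sigmaFiberEquiv cls).tsum_eq, ENNReal.tsum_sigma', tsum_fintype]
  have key : ∀ c, ∑' v : {v // cls v = c}, (euclBall d n).indicator (1 : (Fin d → ℝ) → ENNReal)
      (g.1 *ᵥ toV v.1) ≤ T := by
    intro c
    by_cases hex : ∃ v₀, cls v₀ = c ∧ g.1 *ᵥ toV v₀ ∈ euclBall d n
    · obtain ⟨v₀, hc, h0⟩ := hex
      have hdvd : ∀ v : {v // cls v = c}, ∃ u : Fin d → ℤ, v.1 = v₀ + ((2 * n : ℕ) : ℤ) • u := by
        rintro ⟨v, hv⟩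
        have : ∀ i, ∃ u, v i = v₀ i + ((2 * n : ℕ) : ℤ) * u := by
          intro i
          have h1 : (v₀ i : ZMod (2 * n)) = v i := congrFun (hc.trans hv.symm) i
          obtain ⟨u, hu⟩ := (ZMod.intCast_eq_intCast_iff_dvd_sub _ _ _).1 h1
          exact ⟨u, by linarith⟩
        choose u hu using this
        exact ⟨u, funext hu⟩
      choose φ hφ using hdvd
      have hinj : Function.Injective φ := by
        intro v w h
        apply Subtype.ext
        rw [hφ v, hφ w, h]
      refine (ENNReal.tsum_le_tsum fun v => ?_).trans
        (ENNReal.tsum_comp_le_tsum_of_injective hinj _)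
      by_cases hv : g.1 *ᵥ toV v.1 ∈ euclBall d n
      · rw [Set.indicator_of_mem hv, Set.indicator_of_mem]
        · rfl
        have h2 : (2 * n : ℝ) • (g.1 *ᵥ toV (φ v)) = g.1 *ᵥ toV v.1 - g.1 *ᵥ toV v₀ := by
          rw [← mulVec_sub, ← mulVec_smul]
          congr 1
          have h3 := hφ v
          ext i
          have h4 := congrFun h3 i
          simp only [toV, Pi.smul_apply, Pi.sub_apply, smul_eq_mul]
          rw [h4]
          simp
        have h5 : (2 * n : ℝ) / (2 * n) = 1 := by field_simp
        refine (congrArg (g.1 *ᵥ toV (φ v) ∈ euclBall d ·) h5).mp ?_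
        rw [← toLp_smul_mem_euclBall (by positivity), h2, mem_euclBall, WithLp.toLp_sub]
        have h6 : ‖WithLp.toLp 2 (g.1 *ᵥ toV v.1)‖ < n := hv
        have h7 : ‖WithLp.toLp 2 (g.1 *ᵥ toV v₀)‖ < n := h0
        have := norm_sub_le (WithLp.toLp 2 (g.1 *ᵥ toV v.1)) (WithLp.toLp 2 (g.1 *ᵥ toV v₀))
        linarith
      · rw [Set.indicator_of_notMem hv]
        exact zero_le
    · push Not at hex
      have h0 : ∀ v : {v // cls v = c}, (euclBall d n).indicator (1 : (Fin d → ℝ) → ENNReal)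
          (g.1 *ᵥ toV v.1) = 0 := fun v => Set.indicator_of_notMem (hex v.1 v.2) 1
      rw [ENNReal.tsum_eq_zero.2 h0]
      exact zero_le
  refine (Finset.sum_le_card_nsmul _ _ T fun c _ => key c).trans ?_
  rw [Finset.card_univ, Fintype.card_fun, ZMod.card, Fintype.card_fin, nsmul_eq_mul]
  push_cast
  exact le_rfl

end Counting

section MeanValue

open Matrix

variable {d : ℕ}

theorem cols_toR (γ : Matrix.SpecialLinearGroup (Fin d) ℤ) (j : Fin d) :
    cols (toR γ) j = toV (γ.1 *ᵥ Pi.single j 1) := by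
  ext i
  simp [cols, toR_apply, toV]

theorem cols_mul_toR (g : SLR d) (γ : Matrix.SpecialLinearGroup (Fin d) ℤ) (j : Fin d) :
    cols (g * toR γ) j = g.1 *ᵥ toV (γ.1 *ᵥ Pi.single j 1) := by
  rw [cols_mul, cols_toR]

theorem exists_mul_toR_mem_redFam {k : ℕ} {r : ℝ} {g : SLR d}
    (h : ∀ j : Fin d, (j : ℕ) < k → cols g j ∈ euclBall d (2 * r)) :
    ∃ γ, FixesFirst k γ ∧ cols (g * toR γ) ∈ redFam d k r := by
  obtain ⟨γ, hγ, H⟩ := exists_fixesFirst_forall_mem_redSet k g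
  refine ⟨γ, hγ, fun j => ?_⟩
  by_cases hj : (j : ℕ) < k
  · rw [if_pos hj, cols_mul_toR_of_fixesFirst g hγ hj]
    exact h j hj
  · rw [if_neg hj]
    exact H j (not_lt.1 hj)

theorem isInvWeight_one : IsInvWeight (1 : (Fin d → ℤ) → ENNReal) := fun _ _ => rfl

variable [NeZero d]

theorem FixesFirst.mulVec_single_zero {k : ℕ} (hk : 0 < k)
    {γ : Matrix.SpecialLinearGroup (Fin d) ℤ} (hγ : FixesFirst k γ) :
    γ.1 *ᵥ Pi.single 0 1 = Pi.single 0 1 := by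
  refine hγ.mulVec_eq fun i hi => Pi.single_eq_of_ne ?_ _
  rintro rfl
  simp only [Fin.val_zero] at hi
  omega

theorem tsum_indicator_le_orbSum {P : Set (Fin d → ℤ)} {S : Set (Fin d → Fin d → ℝ)} (g : SLR d)
    (h : ∀ v ∈ P, ∃ γ : Matrix.SpecialLinearGroup (Fin d) ℤ,
      γ.1 *ᵥ Pi.single 0 1 = v ∧ cols (g * toR γ) ∈ S) :
    ∑' v, P.indicator (1 : (Fin d → ℤ) → ENNReal) v ≤
      orbSum ((cols ⁻¹' S).indicator 1) (QuotientGroup.mk g) := by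
  choose! φ hφ hS using h
  rw [← tsum_subtype, orbSum_mk]
  have hinj : Function.Injective fun v : P => φ v := by
    intro v w hvw
    apply Subtype.ext
    rw [← hφ v v.2, ← hφ w w.2]
    exact congrArg (fun γ : Matrix.SpecialLinearGroup (Fin d) ℤ => γ.1 *ᵥ Pi.single 0 1) hvw
  refine (ENNReal.tsum_le_tsum fun v => ?_).trans
    (ENNReal.tsum_comp_le_tsum_of_injective hinj _)
  have h1 : g * toR (φ v) ∈ cols ⁻¹' S := hS v v.2
  rw [Set.indicator_of_mem h1]
  rfl

/-- The number of primitive vectors of a lattice in the ball of radius `r`. -/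
def primCount (r : ℝ) : LatticeSpace d → ENNReal :=
  vecSum ((Prim d).indicator 1) ((euclBall d r).indicator 1)

theorem primCount_mk (r : ℝ) (g : SLR d) : primCount r (QuotientGroup.mk g) =
    ∑' v, (Prim d ∩ {v | g.1 *ᵥ toV v ∈ euclBall d r}).indicator (1 : (Fin d → ℤ) → ENNReal) v := by
  rw [primCount, vecSum_mk isInvWeight_Prim]
  refine tsum_congr fun v => ?_
  rw [Set.inter_indicator_one]
  rfl

theorem measurable_primCount (r : ℝ) : Measurable (primCount (d := d) r) :=
  measurable_vecSum isInvWeight_Prim (measurable_one.indicator (measurableSet_euclBall r))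

theorem primCount_le_orbSum {r : ℝ} (hr : 0 ≤ r) (x : LatticeSpace d) :
    primCount r x ≤ orbSum ((cols ⁻¹' redFam d 1 r).indicator 1) x := by
  induction x using QuotientGroup.induction_on with
  | H g =>
  rw [primCount_mk]
  refine tsum_indicator_le_orbSum g ?_
  rintro _ ⟨⟨γ, rfl⟩, hγ⟩
  have hγ' : ‖WithLp.toLp 2 (g.1 *ᵥ toV (γ.1 *ᵥ Pi.single 0 1))‖ < r := hγ
  obtain ⟨γ', h1, h2⟩ := exists_mul_toR_mem_redFam (k := 1) (r := r) (g := g * toR γ) (by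
    intro j hj
    have : j = 0 := Fin.ext (by simpa using hj)
    subst this
    rw [cols_mul_toR, mem_euclBall]
    linarith)
  refine ⟨γ * γ', ?_, by rwa [map_mul, ← mul_assoc]⟩
  change (γ.1 * γ'.1) *ᵥ Pi.single 0 1 = _
  rw [← mulVec_mulVec, h1.mulVec_single_zero one_pos]

theorem lintegral_orbSum_redFam_le (μ : Measure (LatticeSpace d)) [IsProbabilityMeasure μ]
    (hinv : ∀ (g : SLR d) (s : Set (LatticeSpace d)), μ ((g • ·) ⁻¹' s) = μ s) {k : ℕ}
    (hk : k ≤ d) : ∃ K : ENNReal, K ≠ ⊤ ∧ ∀ r : ℝ, 0 ≤ r →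
      ∫⁻ x, orbSum ((cols ⁻¹' redFam d k r).indicator 1) x ∂μ ≤ K * ENNReal.ofReal r ^ (d * k) := by
  obtain ⟨κ, hκ, H⟩ := lintegral_le_volume_of_le_tsum (NeZero.ne d) μ hinv
  obtain ⟨K, hK, H'⟩ := exists_volume_redFam_le (NeZero.ne d) hk
  refine ⟨κ * K, ENNReal.mul_ne_top hκ hK, fun r hr => ?_⟩
  refine (H _ (measurableSet_redFam k r) fun b hb s hs hs1 => smul_mem_redFam hb hs hs1).trans ?_
  rw [mul_assoc]
  gcongr
  exact H' r hr

theorem lintegral_primCount_eq_vecMeasure (μ : Measure (LatticeSpace d)) (r : ℝ) :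
    ∫⁻ x, primCount r x ∂μ = vecMeasure isInvWeight_Prim μ (euclBall d r) :=
  (vecMeasure_apply isInvWeight_Prim μ (measurableSet_euclBall r)).symm

variable {μ : Measure (LatticeSpace d)} [IsProbabilityMeasure μ]

theorem lintegral_primCount_lt_top
    (hinv : ∀ (g : SLR d) (s : Set (LatticeSpace d)), μ ((g • ·) ⁻¹' s) = μ s) {r : ℝ}
    (hr : 0 ≤ r) : ∫⁻ x, primCount r x ∂μ < ⊤ := by
  obtain ⟨K, hK, H⟩ := lintegral_orbSum_redFam_le μ hinv (k := 1) NeZero.one_le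
  refine (lintegral_mono (primCount_le_orbSum hr)).trans_lt ((H r hr).trans_lt ?_)
  exact ENNReal.mul_lt_top hK.lt_top (ENNReal.pow_lt_top ENNReal.ofReal_lt_top)

theorem lintegral_primCount_eq_pow_mul (hd : 2 ≤ d)
    (hinv : ∀ (g : SLR d) (s : Set (LatticeSpace d)), μ ((g • ·) ⁻¹' s) = μ s) {r : ℝ}
    (hr : 0 < r) :
    ∫⁻ x, primCount r x ∂μ = ENNReal.ofReal r ^ d * ∫⁻ x, primCount 1 x ∂μ := by
  rw [lintegral_primCount_eq_vecMeasure, lintegral_primCount_eq_vecMeasure]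
  have : IsLocallyFiniteMeasure (vecMeasure isInvWeight_Prim μ) := ⟨fun x =>
    ⟨euclBall d (‖WithLp.toLp 2 x‖ + 1),
      (isOpen_euclBall _).mem_nhds (lt_add_one ‖WithLp.toLp 2 x‖),
      by
        rw [← lintegral_primCount_eq_vecMeasure]
        exact lintegral_primCount_lt_top hinv (by positivity)⟩⟩
  refine measure_euclBall_eq hd (map_vecMeasure _ hinv) (vecMeasure_singleton_zero _ ?_ μ) hr
  exact Set.indicator_of_notMem (fun h => ne_zero_of_mem_Prim h rfl) _

theorem vecSum_one_eq (hd : 2 ≤ d) {r : ℝ} (hr : 0 < r) (x : LatticeSpace d) :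
    vecSum 1 ((euclBall d r).indicator 1) x = 1 + ∑' n : ℕ+, primCount (r / (n : ℕ)) x := by
  set f : (Fin d → ℤ) → ENNReal := fun v =>
    (euclBall d r).indicator (1 : (Fin d → ℝ) → ENNReal) (x.out.1 *ᵥ toV v) with hf
  have h0 : f 0 = 1 := by
    have : x.out.1 *ᵥ toV 0 = 0 := mulVec_toV_eq_zero.2 rfl
    rw [hf]
    simp only [this]
    refine Set.indicator_of_mem ?_ _
    rw [mem_euclBall]
    simpa using hr
  have h1 : vecSum 1 ((euclBall d r).indicator 1) x = ∑' v, f v := tsum_congr fun v => one_mul _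
  rw [h1, ← ENNReal.summable.tsum_add_tsum_compl (s := {0}) ENNReal.summable, tsum_singleton, h0]
  congr 1
  have h2 := (Equiv.ofBijective _ (bijective_smul_Prim hd)).tsum_eq
    fun v : {v : Fin d → ℤ // v ≠ 0} => f v.1
  refine h2.symm.trans ?_
  rw [ENNReal.tsum_prod']
  refine tsum_congr fun n => ?_
  have hn : (0 : ℝ) < (n : ℕ) := by exact_mod_cast n.pos
  rw [primCount, vecSum]
  have h3 : ∀ v : Fin d → ℤ, (Prim d).indicator (1 : (Fin d → ℤ) → ENNReal) v *
      (euclBall d (r / (n : ℕ))).indicator (1 : (Fin d → ℝ) → ENNReal) (x.out.1 *ᵥ toV v) =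
      (Prim d).indicator (fun v => f (((n : ℕ) : ℤ) • v)) v := by
    intro v
    by_cases hv : v ∈ Prim d
    · rw [Set.indicator_of_mem hv, Set.indicator_of_mem hv, Pi.one_apply, one_mul, hf]
      simp only [toV_smul, mulVec_smul]
      have h4 : x.out.1 *ᵥ toV v ∈ euclBall d (r / (n : ℕ)) ↔
          (((n : ℕ) : ℤ) : ℝ) • (x.out.1 *ᵥ toV v) ∈ euclBall d r := by
        rw [Int.cast_natCast, toLp_smul_mem_euclBall hn]
      by_cases h : x.out.1 *ᵥ toV v ∈ euclBall d (r / (n : ℕ))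
      · rw [Set.indicator_of_mem h, Set.indicator_of_mem (h4.1 h)]; rfl
      · rw [Set.indicator_of_notMem h, Set.indicator_of_notMem (mt h4.2 h)]
    · rw [Set.indicator_of_notMem hv, Set.indicator_of_notMem hv, zero_mul]
  rw [tsum_congr h3, ← tsum_subtype]
  rfl

theorem lintegral_vecSum_one (hd : 2 ≤ d)
    (hinv : ∀ (g : SLR d) (s : Set (LatticeSpace d)), μ ((g • ·) ⁻¹' s) = μ s) {r : ℝ}
    (hr : 0 < r) : ∫⁻ x, vecSum 1 ((euclBall d r).indicator 1) x ∂μ = 1 + ENNReal.ofReal r ^ d *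
      (ENNReal.ofReal (∑' n : ℕ+, (1 : ℝ) / (n : ℝ) ^ d) * ∫⁻ x, primCount 1 x ∂μ) := by
  simp_rw [vecSum_one_eq hd hr]
  rw [lintegral_add_left measurable_const,
    lintegral_tsum fun n => (measurable_primCount _).aemeasurable,
    lintegral_one, measure_univ]
  congr 1
  have hsum : Summable fun n : ℕ+ => (1 : ℝ) / (n : ℝ) ^ d :=
    (Real.summable_one_div_nat_pow.2 (by omega)).comp_injective PNat.coe_injective
  rw [ENNReal.ofReal_tsum_of_nonneg (fun n => by positivity) hsum, ← ENNReal.tsum_mul_right,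
    ← ENNReal.tsum_mul_left]
  refine tsum_congr fun n => ?_
  have hn : (0 : ℝ) < (n : ℕ) := by exact_mod_cast n.pos
  rw [lintegral_primCount_eq_pow_mul hd hinv (by positivity), ← mul_assoc,
    ← ENNReal.ofReal_pow hr.le, ← ENNReal.ofReal_pow (by positivity),
    ← ENNReal.ofReal_mul (by positivity), div_pow, mul_one_div]

/-- The mean number of primitive vectors of a random unimodular lattice in the unit ball. -/
theorem ofReal_tsum_mul_lintegral_primCount (hd : 2 ≤ d)
    (hinv : ∀ (g : SLR d) (s : Set (LatticeSpace d)), μ ((g • ·) ⁻¹' s) = μ s) :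
    ENNReal.ofReal (∑' n : ℕ+, (1 : ℝ) / (n : ℝ) ^ d) * ∫⁻ x, primCount 1 x ∂μ =
      volume (euclBall d 1) := by
  set c := ENNReal.ofReal (∑' n : ℕ+, (1 : ℝ) / (n : ℝ) ^ d) * ∫⁻ x, primCount 1 x ∂μ
  set F : ℕ → LatticeSpace d → ENNReal := fun n x =>
    vecSum 1 ((euclBall d n).indicator 1) x / (n : ENNReal) ^ d with hF
  have hFmk : ∀ n g, F n (QuotientGroup.mk g) =
      (∑' v : Fin d → ℤ, (euclBall d n).indicator (1 : (Fin d → ℝ) → ENNReal) (g.1 *ᵥ toV v)) /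
        (n : ENNReal) ^ d := by
    intro n g
    simp only [hF]
    rw [vecSum_mk isInvWeight_one]
    simp only [Pi.one_apply, one_mul]
  have hmeas : ∀ n, Measurable (F n) := fun n =>
    (measurable_vecSum isInvWeight_one
      (measurable_one.indicator (measurableSet_euclBall n))).div_const _
  have hpt : ∀ x, Filter.Tendsto (fun n => F n x) Filter.atTop (nhds (volume (euclBall d 1))) := by
    intro x
    induction x using QuotientGroup.induction_on with
    | H g =>
    have h1 := ENNReal.tendsto_ofReal (tendsto_card_mulVec_mem_euclBall g)
    rw [ofReal_measureReal volume_euclBall_one_lt_top.ne] at h1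
    refine h1.congr' ?_
    filter_upwards [Filter.eventually_gt_atTop 0] with n hn
    have hn' : (0 : ℝ) < n := by exact_mod_cast hn
    rw [hFmk, tsum_indicator_mulVec_eq_card, ENNReal.ofReal_div_of_pos (by positivity),
      ENNReal.ofReal_pow hn'.le, ENNReal.ofReal_natCast, ENNReal.ofReal_natCast]
  have hint : ∀ n : ℕ, 0 < n → ∫⁻ x, F n x ∂μ = 1 / (n : ENNReal) ^ d + c := by
    intro n hn
    have hn' : (0 : ℝ) < n := by exact_mod_cast hn
    have hne : (n : ENNReal) ^ d ≠ 0 := pow_ne_zero _ (by exact_mod_cast hn.ne')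
    have hnt : (n : ENNReal) ^ d ≠ ⊤ := ENNReal.pow_ne_top (ENNReal.natCast_ne_top n)
    simp only [hF, div_eq_mul_inv]
    rw [lintegral_mul_const _ (measurable_vecSum isInvWeight_one
      (measurable_one.indicator (measurableSet_euclBall n))), lintegral_vecSum_one hd hinv hn',
      ENNReal.ofReal_natCast, add_mul, mul_right_comm, ENNReal.mul_inv_cancel hne hnt, one_mul,
      one_mul]
  set G : LatticeSpace d → ENNReal := fun x =>
    2 ^ d * vecSum 1 ((euclBall d 1).indicator 1) x with hG
  have hbound : ∀ n : ℕ, ∀ x, F (n + 1) x ≤ G x := by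
    intro n x
    induction x using QuotientGroup.induction_on with
    | H g =>
    rw [hFmk, hG]
    simp only
    rw [vecSum_mk isInvWeight_one]
    simp only [Pi.one_apply, one_mul]
    refine ENNReal.div_le_of_le_mul ?_
    refine (tsum_indicator_mulVec_le g n.succ_ne_zero).trans (le_of_eq ?_)
    rw [mul_pow]
    ring
  have hGint : ∫⁻ x, G x ∂μ ≠ ⊤ := by
    simp only [hG]
    rw [lintegral_const_mul _ (measurable_vecSum isInvWeight_one
      (measurable_one.indicator (measurableSet_euclBall 1))), lintegral_vecSum_one hd hinv one_pos]
    have := (lintegral_primCount_lt_top hinv zero_le_one).ne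
    finiteness
  have hlim := tendsto_lintegral_of_dominated_convergence G (fun n => hmeas (n + 1))
    (fun n => Filter.Eventually.of_forall (hbound n)) hGint
    (Filter.Eventually.of_forall fun x => (hpt x).comp (Filter.tendsto_add_atTop_nat 1))
  rw [lintegral_const, measure_univ, mul_one] at hlim
  refine tendsto_nhds_unique ?_ hlim
  have h2 : Filter.Tendsto (fun n : ℕ => 1 / ((n + 1 : ℕ) : ENNReal) ^ d + c) Filter.atTop
      (nhds (0 + c)) := by
    refine Filter.Tendsto.add_const c ?_
    have h3 : Filter.Tendsto (fun n : ℕ => (((n + 1 : ℕ) : ENNReal)⁻¹) ^ d) Filter.atTop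
        (nhds (0 ^ d)) :=
      ENNReal.Tendsto.pow (ENNReal.tendsto_inv_nat_nhds_zero.comp (Filter.tendsto_add_atTop_nat 1))
    rw [zero_pow (NeZero.ne d)] at h3
    simpa [ENNReal.inv_pow] using h3
  rw [zero_add] at h2
  exact h2.congr fun n => (hint (n + 1) n.succ_pos).symm

end MeanValue

section Tail

open Matrix

variable {d : ℕ}

theorem neg_mulVec_mem_euclBall {g : SLR d} {v : Fin d → ℤ} {r : ℝ} :
    g.1 *ᵥ toV (-v) ∈ euclBall d r ↔ g.1 *ᵥ toV v ∈ euclBall d r := by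
  have h : toV (-v) = -toV v := by ext; simp [toV]
  rw [mem_euclBall, mem_euclBall, h, mulVec_neg, WithLp.toLp_neg, norm_neg]

variable [NeZero d]

theorem ne_neg_of_mem_Prim {v : Fin d → ℤ} (hv : v ∈ Prim d) : v ≠ -v := fun h =>
  ne_zero_of_mem_Prim hv (self_eq_neg.1 h)

theorem two_le_primCount (hd : 2 ≤ d) {g : SLR d} {r : ℝ} {v : Fin d → ℤ} (hv : v ∈ Prim d)
    (hr : g.1 *ᵥ toV v ∈ euclBall d r) : 2 ≤ primCount r (QuotientGroup.mk g) := by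
  rw [primCount_mk]
  refine le_trans (le_of_eq ?_) (ENNReal.sum_le_tsum {v, -v})
  have h1 : v ∈ Prim d ∩ {v | g.1 *ᵥ toV v ∈ euclBall d r} := ⟨hv, hr⟩
  have h2 : -v ∈ Prim d ∩ {v | g.1 *ᵥ toV v ∈ euclBall d r} :=
    ⟨neg_mem_Prim hd hv, neg_mulVec_mem_euclBall.2 hr⟩
  rw [Finset.sum_pair (ne_neg_of_mem_Prim hv), Set.indicator_of_mem h1, Set.indicator_of_mem h2]
  simp only [Pi.one_apply]
  exact one_add_one_eq_two.symm

theorem primCount_ne_zero_iff (hd : 2 ≤ d) {g : SLR d} {r : ℝ} :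
    primCount r (QuotientGroup.mk g) ≠ 0 ↔ ∃ v ∈ Prim d, g.1 *ᵥ toV v ∈ euclBall d r := by
  constructor
  · contrapose!
    intro h
    rw [primCount_mk]
    exact ENNReal.tsum_eq_zero.2 fun v => Set.indicator_of_notMem (fun hv => h v hv.1 hv.2) 1
  · rintro ⟨v, hv, hr⟩
    exact ((zero_lt_two).trans_le (two_le_primCount hd hv hr)).ne'

/-- Two non-proportional primitive vectors in a ball yield a reduced basis starting with the first
one and a second short vector. -/
theorem exists_mem_redFam_two (hd : 2 ≤ d) {g : SLR d} {r : ℝ} {p q : Fin d → ℤ} (hp : p ∈ Prim d)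
    (hq : q ∈ Prim d) (hpr : g.1 *ᵥ toV p ∈ euclBall d r) (hqr : g.1 *ᵥ toV q ∈ euclBall d r)
    (h1 : q ≠ p) (h2 : q ≠ -p) : ∃ γ : Matrix.SpecialLinearGroup (Fin d) ℤ,
      γ.1 *ᵥ Pi.single 0 1 = p ∧ cols (g * toR γ) ∈ redFam d 2 r := by
  obtain ⟨γ, hγ⟩ := hp
  have hγ' : γ.1 *ᵥ Pi.single 0 1 = p := hγ
  set j : Fin d := ⟨1, hd⟩ with hj
  have hj0 : ∀ l : Fin d, l < j ↔ l = 0 := by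
    intro l
    have hj1 : (j : ℕ) = 1 := rfl
    rw [Fin.lt_def, Fin.ext_iff, Fin.val_zero, hj1, Nat.lt_one_iff]
  have hinv : γ.1 * (γ⁻¹).1 = 1 := congrArg Subtype.val (mul_inv_cancel γ)
  set w : Fin d → ℤ := (γ⁻¹).1 *ᵥ q with hw
  have hwq : γ.1 *ᵥ w = q := by rw [hw, mulVec_mulVec, hinv, one_mulVec]
  have hwP : w ∈ Prim d := (mulVec_mem_Prim _).2 hq
  have hex : ∃ i, j ≤ i ∧ w i ≠ 0 := by
    by_contra! hcon
    have hw0 : w = w 0 • Pi.single 0 1 := by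
      ext i
      by_cases hi : i = 0
      · subst hi; simp
      · rw [hcon i (not_lt.1 (mt (hj0 i).1 hi))]
        simp [hi]
    have hu : IsUnit (w 0) := isUnit_of_smul_mem_Prim (v := Pi.single 0 1) (hw0 ▸ hwP)
    have hq' : q = w 0 • p := by rw [← hwq, hw0, mulVec_smul, hγ']; simp
    rcases Int.isUnit_iff.1 hu with h | h
    · exact h1 (by rw [hq', h, one_smul])
    · exact h2 (by rw [hq', h, neg_smul, one_smul])
  obtain ⟨n, hn, H⟩ := exists_fixesFirst_column j w hex
  obtain ⟨δ, hδ, θ, hθ, hθ', hcol⟩ := H 0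
  have hδ0 := hδ.mulVec_single_zero (by simp [hj])
  have hθ0 : |θ 0| ≤ 1 / 2 := by simpa using hθ' 0 ((hj0 0).2 rfl)
  have hmul : (γ * δ).1 *ᵥ Pi.single 0 1 = p := by
    change (γ.1 * δ.1) *ᵥ Pi.single 0 1 = _
    rw [← mulVec_mulVec, hδ0, hγ']
  have hvec : toV (δ.1 *ᵥ Pi.single j 1) = (n : ℝ)⁻¹ • toV w + θ 0 • toV (Pi.single 0 1) := by
    ext l
    have h3 : (δ.1 *ᵥ Pi.single j 1) l = δ.1 l j := by simp
    simp only [toV, h3, hcol, Pi.add_apply, Pi.smul_apply, smul_eq_mul]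
    rw [div_eq_inv_mul]
    congr 1
    by_cases hl : l = 0
    · subst hl; simp
    · rw [hθ l (not_lt.1 (mt (hj0 l).1 hl))]
      simp [hl]
  have hcolj : cols (g * toR (γ * δ)) j = (n : ℝ)⁻¹ • (g.1 *ᵥ toV q) + θ 0 • (g.1 *ᵥ toV p) := by
    rw [cols_mul_toR]
    change g.1 *ᵥ toV ((γ.1 * δ.1) *ᵥ Pi.single j 1) = _
    rw [← mulVec_mulVec, toV_mulVec, hvec, mulVec_add, mulVec_smul, mulVec_smul, ← toV_mulVec,
      ← toV_mulVec, hwq, hγ', mulVec_add, mulVec_smul, mulVec_smul]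
  have hpr' : ‖WithLp.toLp 2 (g.1 *ᵥ toV p)‖ < r := hpr
  have hqr' : ‖WithLp.toLp 2 (g.1 *ᵥ toV q)‖ < r := hqr
  have hr : 0 < r := (norm_nonneg _).trans_lt hpr'
  have hn1 : |(n : ℝ)⁻¹| ≤ 1 := by
    rw [abs_inv]
    refine inv_le_one_of_one_le₀ ?_
    exact_mod_cast Int.one_le_abs hn
  obtain ⟨ε, hε, hred⟩ := exists_mul_toR_mem_redFam (k := 2) (r := r) (g := g * toR (γ * δ)) (by
    intro i hi
    rcases Nat.lt_succ_iff_lt_or_eq.1 hi with hi | hi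
    · have : i = 0 := Fin.ext (by simpa using hi)
      subst this
      rw [cols_mul_toR, hmul, mem_euclBall]
      linarith
    · have : i = j := Fin.ext hi
      subst this
      rw [hcolj, mem_euclBall, WithLp.toLp_add, WithLp.toLp_smul, WithLp.toLp_smul]
      refine (norm_add_le _ _).trans_lt ?_
      rw [norm_smul, norm_smul, Real.norm_eq_abs, Real.norm_eq_abs]
      have e1 := mul_le_mul hn1 hqr'.le (norm_nonneg _) zero_le_one
      have e2 := mul_le_mul hθ0 hpr'.le (norm_nonneg _) (by norm_num)
      linarith)
  refine ⟨γ * δ * ε, ?_, by rwa [map_mul, ← mul_assoc]⟩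
  change ((γ * δ).1 * ε.1) *ᵥ Pi.single 0 1 = _
  rw [← mulVec_mulVec, hε.mulVec_single_zero two_pos, hmul]

theorem primCount_le_add_orbSum (hd : 2 ≤ d) {r : ℝ} (x : LatticeSpace d) :
    primCount r x ≤ 2 * {x | primCount r x ≠ 0}.indicator 1 x +
      orbSum ((cols ⁻¹' redFam d 2 r).indicator 1) x := by
  induction x using QuotientGroup.induction_on with
  | H g =>
  by_cases h0 : primCount r (QuotientGroup.mk g : LatticeSpace d) = 0
  · rw [h0]
    exact zero_le
  have hmem : (QuotientGroup.mk g : LatticeSpace d) ∈ {x : LatticeSpace d | primCount r x ≠ 0} := h0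
  rw [Set.indicator_of_mem hmem, Pi.one_apply, mul_one]
  obtain ⟨p₀, hp₀, hpr₀⟩ := (primCount_ne_zero_iff hd).1 h0
  by_cases hex : ∃ q ∈ Prim d, g.1 *ᵥ toV q ∈ euclBall d r ∧ q ≠ p₀ ∧ q ≠ -p₀
  · obtain ⟨q₀, hq₀, hqr₀, hne, hne'⟩ := hex
    refine le_trans ?_ le_add_self
    rw [primCount_mk]
    refine tsum_indicator_le_orbSum g ?_
    rintro p ⟨hp, hpr⟩
    by_cases hpp : p₀ ≠ p ∧ p₀ ≠ -p
    · exact exists_mem_redFam_two hd hp hp₀ hpr hpr₀ hpp.1 hpp.2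
    · refine exists_mem_redFam_two hd hp hq₀ hpr hqr₀ ?_ ?_
      · rintro rfl
        exact hpp ⟨hne.symm, fun h => hne' (by rw [h, neg_neg])⟩
      · intro h
        refine hpp ⟨fun h' => hne' (by rw [h, h']), fun h' => hne (by rw [h, h'])⟩
  · push Not at hex
    refine le_trans ?_ le_self_add
    rw [primCount_mk, tsum_eq_sum (s := {p₀, -p₀})]
    · have hle : ∀ v ∈ ({p₀, -p₀} : Finset (Fin d → ℤ)),
          (Prim d ∩ {v | g.1 *ᵥ toV v ∈ euclBall d r}).indicator (1 : (Fin d → ℤ) → ENNReal) v ≤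
            1 := fun v _ => Set.indicator_le_self _ _ _
      refine (Finset.sum_le_card_nsmul _ _ 1 hle).trans ?_
      rw [Finset.card_pair (ne_neg_of_mem_Prim hp₀)]
      simp
    · intro v hv
      refine Set.indicator_of_notMem (fun hmem => hv ?_) _
      rw [Finset.mem_insert, Finset.mem_singleton]
      by_cases h : v = p₀
      · exact Or.inl h
      · exact Or.inr (hex v hmem.1 hmem.2 h)

theorem measure_primCount_ne_zero_bounds (hd : 2 ≤ d) {μ : Measure (LatticeSpace d)}
    [IsProbabilityMeasure μ]
    (hinv : ∀ (g : SLR d) (s : Set (LatticeSpace d)), μ ((g • ·) ⁻¹' s) = μ s) :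
    ∃ K : ENNReal, K ≠ ⊤ ∧ ∀ r : ℝ, 0 < r →
      2 * μ {x | primCount r x ≠ 0} ≤ ENNReal.ofReal r ^ d * ∫⁻ x, primCount 1 x ∂μ ∧
      ENNReal.ofReal r ^ d * ∫⁻ x, primCount 1 x ∂μ ≤
        2 * μ {x | primCount r x ≠ 0} + K * ENNReal.ofReal r ^ (d * 2) := by
  obtain ⟨K, hK, H⟩ := lintegral_orbSum_redFam_le μ hinv hd
  refine ⟨K, hK, fun r hr => ?_⟩
  have hT : MeasurableSet {x : LatticeSpace d | primCount r x ≠ 0} :=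
    measurable_primCount r (measurableSet_singleton 0).compl
  have hint : ∫⁻ x, 2 * {x : LatticeSpace d | primCount r x ≠ 0}.indicator 1 x ∂μ =
      2 * μ {x | primCount r x ≠ 0} := by
    rw [lintegral_const_mul _ (measurable_one.indicator hT), lintegral_indicator_one hT]
  rw [← lintegral_primCount_eq_pow_mul hd hinv hr, ← hint]
  constructor
  · refine lintegral_mono fun x => ?_
    by_cases h : x ∈ {x : LatticeSpace d | primCount r x ≠ 0}
    · rw [Set.indicator_of_mem h, Pi.one_apply, mul_one]
      induction x using QuotientGroup.induction_on with
      | H g =>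
      obtain ⟨v, hv, hvr⟩ := (primCount_ne_zero_iff hd).1 h
      exact two_le_primCount hd hv hvr
    · rw [Set.indicator_of_notMem h, mul_zero]
      exact zero_le
  · refine (lintegral_mono (primCount_le_add_orbSum hd)).trans ?_
    rw [lintegral_add_left ((measurable_one.indicator hT).const_mul _)]
    gcongr
    exact H r hr.le

end Tail

section Minimum

open Matrix

variable {d : ℕ}

theorem latVec_eq (g : SLR d) (v : Fin d → ℤ) : latVec g v = WithLp.toLp 2 (g.1 *ᵥ toV v) := rfl

theorem latVec_ne_zero {g : SLR d} {v : Fin d → ℤ} : latVec g v ≠ 0 ↔ v ≠ 0 := by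
  rw [latVec_eq, ne_eq, WithLp.toLp_eq_zero, mulVec_toV_eq_zero]

variable [NeZero d]

theorem norm_set_nonempty (g : SLR d) :
    {r : ℝ | ∃ v : Fin d → ℤ, latVec g v ≠ 0 ∧ ‖latVec g v‖ = r}.Nonempty :=
  ⟨_, Pi.single 0 1, latVec_ne_zero.2 (by simp), rfl⟩

theorem gMin_pos (g : SLR d) : 0 < gMin g := by
  obtain ⟨M, hM, H⟩ := exists_norm_le_mulVec g
  refine (inv_pos.2 hM).trans_le (le_csInf (norm_set_nonempty g) ?_)
  rintro _ ⟨v, hv, rfl⟩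
  rw [inv_le_iff_one_le_mul₀' hM]
  exact (one_le_norm_toV (latVec_ne_zero.1 hv)).trans (H _)

theorem gMin_lt_iff (hd : 2 ≤ d) {g : SLR d} {r : ℝ} :
    gMin g < r ↔ primCount r (QuotientGroup.mk g : LatticeSpace d) ≠ 0 := by
  rw [gMin, csInf_lt_iff ⟨0, by rintro _ ⟨v, -, rfl⟩; exact norm_nonneg _⟩ (norm_set_nonempty g),
    primCount_ne_zero_iff hd]
  constructor
  · rintro ⟨_, ⟨v, hv, rfl⟩, hr⟩
    obtain ⟨n, p, hp, rfl⟩ := exists_eq_smul_Prim hd (latVec_ne_zero.1 hv)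
    refine ⟨p, hp, ?_⟩
    rw [latVec_eq, toV_smul, mulVec_smul, WithLp.toLp_smul, norm_smul] at hr
    refine lt_of_le_of_lt ?_ hr
    refine le_mul_of_one_le_left (norm_nonneg _) ?_
    rw [Int.cast_natCast, Real.norm_natCast]
    exact Nat.one_le_cast.2 n.pos
  · rintro ⟨p, hp, hr⟩
    exact ⟨_, ⟨p, latVec_ne_zero.2 (ne_zero_of_mem_Prim hp), rfl⟩, hr⟩

theorem image_mk_eq (hd : 2 ≤ d) {a r : ℝ} (hr : 0 < r) (har : r ^ d = a⁻¹) :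
    QuotientGroup.mk '' {g : SLR d | a < (gMin g ^ d)⁻¹} =
      {x : LatticeSpace d | primCount r x ≠ 0} := by
  have ha : 0 < a := inv_pos.1 (har ▸ pow_pos hr d)
  have key : ∀ g : SLR d, a < (gMin g ^ d)⁻¹ ↔
      primCount r (QuotientGroup.mk g : LatticeSpace d) ≠ 0 := by
    intro g
    rw [← gMin_lt_iff hd, lt_inv_comm₀ ha (pow_pos (gMin_pos g) d), ← har,
      pow_lt_pow_iff_left₀ (gMin_pos g).le hr.le (NeZero.ne d)]
  ext x
  constructor
  · rintro ⟨g, hg, rfl⟩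
    exact (key g).1 hg
  · intro hx
    induction x using QuotientGroup.induction_on with
    | H g => exact ⟨g, (key g).2 hx, rfl⟩

theorem volume_closedBall_eq :
    volume (Metric.closedBall (0 : EuclideanSpace ℝ (Fin d)) 1) = volume (euclBall d 1) := by
  rw [euclBall_eq, (PiLp.volume_preserving_toLp _).measure_preimage
    measurableSet_ball.nullMeasurableSet, Measure.addHaar_closedBall_eq_addHaar_ball]

end Minimum

/-- Skriganov/Rogers-type tail estimate: for `d ≥ 2` and
`D = ζ(d)⁻¹·Vol(B̄(0,1))/2`, there are `C > 0` and `a₀ > 0` such that for all `a ≥ a₀`,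
`|μ_d({L : ‖L‖⁻ᵈ > a}) − D·a⁻¹| ≤ C·a⁻²`, where `μ_d` is the normalized Haar probability
measure on `𝒮_d` (formalized as: any `SL_d(ℝ)`-invariant Borel probability measure). -/
theorem stmt7 (d : ℕ) (hd : 2 ≤ d)
    (μ : Measure (LatticeSpace d)) [IsProbabilityMeasure μ]
    (hinv : ∀ (g : SLR d) (s : Set (LatticeSpace d)), μ ((g • ·) ⁻¹' s) = μ s) :
    ∃ C > (0 : ℝ), ∃ a₀ > (0 : ℝ), ∀ a : ℝ, a₀ ≤ a →
      |(μ (QuotientGroup.mk '' {g : SLR d | a < (gMin g ^ d)⁻¹})).toReal -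
          (∑' n : ℕ+, (1 : ℝ) / (n : ℝ) ^ d)⁻¹ *
            (volume (Metric.closedBall (0 : EuclideanSpace ℝ (Fin d)) 1)).toReal / 2 * a⁻¹|
        ≤ C * (a ^ 2)⁻¹ := by
  have : NeZero d := ⟨by omega⟩
  obtain ⟨K, hK, H⟩ := measure_primCount_ne_zero_bounds hd hinv
  have hmean := congrArg ENNReal.toReal (ofReal_tsum_mul_lintegral_primCount hd hinv)
  have hc := (lintegral_primCount_lt_top hinv zero_le_one).ne
  have hsum : Summable fun n : ℕ+ => (1 : ℝ) / (n : ℝ) ^ d :=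
    (Real.summable_one_div_nat_pow.2 (by omega)).comp_injective PNat.coe_injective
  have hζ : 0 < ∑' n : ℕ+, (1 : ℝ) / (n : ℝ) ^ d :=
    hsum.tsum_pos (fun n => by positivity) 1 (by simp)
  rw [ENNReal.toReal_mul, ENNReal.toReal_ofReal hζ.le] at hmean
  refine ⟨K.toReal + 1, by positivity, 1, one_pos, fun a ha => ?_⟩
  have ha0 : 0 < a := by linarith
  set r : ℝ := a⁻¹ ^ (d : ℝ)⁻¹
  have hr : 0 < r := Real.rpow_pos_of_pos (inv_pos.2 ha0) _
  have har : r ^ d = a⁻¹ := Real.rpow_inv_natCast_pow (inv_pos.2 ha0).le (NeZero.ne d)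
  obtain ⟨h1, h2⟩ := H r hr
  have hr2 : ENNReal.ofReal r ^ (d * 2) = ENNReal.ofReal ((a ^ 2)⁻¹) := by
    rw [pow_mul, ← ENNReal.ofReal_pow hr.le, har, ← ENNReal.ofReal_pow (by positivity), inv_pow]
  rw [hr2] at h2
  rw [← ENNReal.ofReal_pow hr.le, har] at h1 h2
  have h1' := ENNReal.toReal_mono (by finiteness) h1
  have h2' := ENNReal.toReal_mono (by finiteness) h2
  rw [ENNReal.toReal_add (by finiteness) (by finiteness)] at h2'
  simp only [ENNReal.toReal_mul, ENNReal.toReal_ofNat,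
    ENNReal.toReal_ofReal (inv_pos.2 ha0).le, ENNReal.toReal_ofReal (inv_pos.2 (pow_pos ha0 2)).le]
    at h1' h2'
  rw [image_mk_eq hd hr har, volume_closedBall_eq, ← hmean, inv_mul_cancel_left₀ hζ.ne']
  have ha2 : 0 < (a ^ 2)⁻¹ := by positivity
  have hK0 : 0 ≤ K.toReal * (a ^ 2)⁻¹ := by positivity
  rw [abs_le]
  constructor <;> linarith
end
end

section
/- For L ∈ 𝒮₂ with ‖L‖ < 1, let α(L) ∈ [−π/2, π/2] denote the angle between the x-axis and the line through 0 spanned by a shortest nonzero vector of L (this line is unique when ‖L‖ < 1). Then, conditionally on the event {‖L‖ < 1}, the random variables α(L) and ‖L‖ are independent: for all −π/2 ≤ a ≤ b ≤ π/2 and all 0 < r₁ ≤ r₂ < 1, μ₂({α(L) ∈ [a,b]} ∩ {‖L‖ ∈ [r₁,r₂]}) · μ₂({‖L‖ < 1}) = μ₂({α(L) ∈ [a,b]} ∩ {‖L‖ < 1}) · μ₂({‖L‖ ∈ [r₁,r₂]}). -/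
noncomputable section

open MeasureTheory

/-- The angle in `[−π/2, π/2]` between the `x`-axis and the line `ℝ·x` through the
origin spanned by a nonzero vector `x ∈ ℝ²`. -/
def lineAngle (x : EuclideanSpace ℝ (Fin 2)) : ℝ :=
  if x 0 = 0 then Real.pi / 2 else Real.arctan (x 1 / x 0)

instance : MeasurableSpace Circle := borel Circle

instance : BorelSpace Circle := ⟨rfl⟩

/-- Finite left-invariant measures on a compact group are proportional. -/
lemma mul_measure_univ_comm_of_isMulLeftInvariant {G : Type*} [TopologicalSpace G] [Group G]
    [IsTopologicalGroup G] [CompactSpace G] [SecondCountableTopology G] [MeasurableSpace G]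
    [BorelSpace G] (ν₁ ν₂ : Measure G) [IsFiniteMeasure ν₁] [IsFiniteMeasure ν₂]
    [ν₁.IsMulLeftInvariant] [ν₂.IsMulLeftInvariant] (A : Set G) :
    ν₁ A * ν₂ Set.univ = ν₂ A * ν₁ Set.univ := by
  rw [Measure.isMulLeftInvariant_eq_smul ν₁ (Measure.haarMeasure ⊤),
    Measure.isMulLeftInvariant_eq_smul ν₂ (Measure.haarMeasure ⊤)]
  simp only [Measure.smul_apply, ENNReal.smul_def, smul_eq_mul]
  ring

section LatticeVectors

lemma latVec_zero (g : SLR 2) (v : Fin 2 → ℤ) :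
    latVec g v 0 = g.1 0 0 * v 0 + g.1 0 1 * v 1 := by
  simp [latVec]

lemma latVec_one (g : SLR 2) (v : Fin 2 → ℤ) :
    latVec g v 1 = g.1 1 0 * v 0 + g.1 1 1 * v 1 := by
  simp [latVec]

lemma SLR_det (g : SLR 2) : g.1 0 0 * g.1 1 1 - g.1 0 1 * g.1 1 0 = 1 := by
  rw [← Matrix.det_fin_two]
  exact g.2

lemma coord_zero_eq (g : SLR 2) (v : Fin 2 → ℤ) :
    (v 0 : ℝ) = g.1 1 1 * latVec g v 0 - g.1 0 1 * latVec g v 1 := by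
  rw [latVec_zero, latVec_one]
  linear_combination -(v 0 : ℝ) * SLR_det g

lemma coord_one_eq (g : SLR 2) (v : Fin 2 → ℤ) :
    (v 1 : ℝ) = g.1 0 0 * latVec g v 1 - g.1 1 0 * latVec g v 0 := by
  rw [latVec_zero, latVec_one]
  linear_combination -(v 1 : ℝ) * SLR_det g

lemma norm_sq_eq_coords (x : EuclideanSpace ℝ (Fin 2)) : ‖x‖ ^ 2 = x 0 ^ 2 + x 1 ^ 2 := by
  simp [EuclideanSpace.norm_sq_eq, Fin.sum_univ_two]

lemma abs_coord_le_norm (x : EuclideanSpace ℝ (Fin 2)) (i : Fin 2) : |x i| ≤ ‖x‖ := by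
  simpa using PiLp.norm_apply_le x i

lemma measurable_latVec_apply (v : Fin 2 → ℤ) (i : Fin 2) :
    Measurable fun g : SLR 2 => latVec g v i := by
  have entry (i j : Fin 2) : Measurable fun g : SLR 2 => g.1 i j :=
    (measurable_pi_apply j).comp ((measurable_pi_apply i).comp measurable_subtype_coe)
  fin_cases i
  · simp only [Fin.zero_eta, latVec_zero]
    exact ((entry 0 0).mul_const _).add ((entry 0 1).mul_const _)
  · simp only [Fin.mk_one, latVec_one]
    exact ((entry 1 0).mul_const _).add ((entry 1 1).mul_const _)

lemma measurable_latVec (v : Fin 2 → ℤ) : Measurable fun g : SLR 2 => latVec g v :=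
  (MeasurableEquiv.toLp 2 (Fin 2 → ℝ)).measurable.comp
    (measurable_pi_lambda _ fun i => measurable_latVec_apply v i)

lemma measurable_lineAngle : Measurable lineAngle := by
  have coord (i : Fin 2) : Measurable fun x : EuclideanSpace ℝ (Fin 2) => x i := by fun_prop
  exact Measurable.ite (coord 0 (measurableSet_singleton 0)) measurable_const
    (Real.measurable_arctan.comp ((coord 1).div (coord 0)))

end LatticeVectors

section MinimalNorm

lemma exists_latVec_ne_zero (g : SLR 2) : ∃ v, latVec g v ≠ 0 := by
  refine ⟨![1, 0], fun h => ?_⟩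
  have := coord_zero_eq g ![1, 0]
  simp [h] at this

lemma gMin_lt_iff_s9 (g : SLR 2) (c : ℝ) :
    gMin g < c ↔ ∃ v, latVec g v ≠ 0 ∧ ‖latVec g v‖ < c := by
  have hbdd : BddBelow {r : ℝ | ∃ v : Fin 2 → ℤ, latVec g v ≠ 0 ∧ ‖latVec g v‖ = r} :=
    ⟨0, by rintro _ ⟨v, -, rfl⟩; exact norm_nonneg _⟩
  obtain ⟨v, hv⟩ := exists_latVec_ne_zero g
  rw [gMin, csInf_lt_iff hbdd ⟨_, v, hv, rfl⟩]
  constructor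
  · rintro ⟨_, ⟨v, hv, rfl⟩, h⟩
    exact ⟨v, hv, h⟩
  · rintro ⟨v, hv, h⟩
    exact ⟨_, ⟨v, hv, rfl⟩, h⟩

lemma gMin_le (g : SLR 2) {v : Fin 2 → ℤ} (hv : latVec g v ≠ 0) : gMin g ≤ ‖latVec g v‖ :=
  le_of_forall_gt fun _ hc => (gMin_lt_iff_s9 g _).2 ⟨v, hv, hc⟩

lemma finite_norm_latVec_le (g : SLR 2) (R : ℝ) : {v | ‖latVec g v‖ ≤ R}.Finite := by
  obtain ⟨N, hN⟩ := exists_nat_ge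
    ((|g.1 0 0| + |g.1 0 1| + |g.1 1 0| + |g.1 1 1|) * R)
  refine (Set.finite_Icc (fun _ => -(N : ℤ)) fun _ => (N : ℤ)).subset fun v hv => ?_
  have bound (p q : ℝ)
      (hpq : |p| + |q| ≤ |g.1 0 0| + |g.1 0 1| + |g.1 1 0| + |g.1 1 1|) (i j : Fin 2) :
      |p * latVec g v i - q * latVec g v j| ≤ N := by
    have hR : ‖latVec g v‖ ≤ R := hv
    have hi := (abs_coord_le_norm (latVec g v) i).trans hR
    have hj := (abs_coord_le_norm (latVec g v) j).trans hR
    have hR0 : 0 ≤ R := (norm_nonneg _).trans hR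
    calc _ ≤ |p| * |latVec g v i| + |q| * |latVec g v j| := by
          rw [← abs_mul, ← abs_mul]; exact abs_sub _ _
      _ ≤ |p| * R + |q| * R := by gcongr
      _ = (|p| + |q|) * R := by ring
      _ ≤ _ := mul_le_mul_of_nonneg_right hpq hR0
      _ ≤ N := hN
  have h0 : |(v 0 : ℝ)| ≤ N := by
    rw [coord_zero_eq g v]
    exact bound _ _ (by linarith [abs_nonneg (g.1 0 0), abs_nonneg (g.1 1 0)]) _ _
  have h1 : |(v 1 : ℝ)| ≤ N := by
    rw [coord_one_eq g v]
    exact bound _ _ (by linarith [abs_nonneg (g.1 0 1), abs_nonneg (g.1 1 1)]) _ _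
  rw [abs_le] at h0 h1
  refine ⟨Fin.forall_fin_two.2 ⟨?_, ?_⟩, Fin.forall_fin_two.2 ⟨?_, ?_⟩⟩
  · exact_mod_cast h0.1
  · exact_mod_cast h1.1
  · exact_mod_cast h0.2
  · exact_mod_cast h1.2

lemma exists_norm_latVec_eq_gMin (g : SLR 2) :
    ∃ v, latVec g v ≠ 0 ∧ ‖latVec g v‖ = gMin g := by
  obtain ⟨u, hu, hu1⟩ := (gMin_lt_iff_s9 g (gMin g + 1)).1 (by linarith)
  have hfin : {v | latVec g v ≠ 0 ∧ ‖latVec g v‖ ≤ gMin g + 1}.Finite :=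
    (finite_norm_latVec_le g (gMin g + 1)).subset fun v hv => hv.2
  obtain ⟨v, ⟨hv, hv1⟩, hmin⟩ :=
    Set.exists_min_image _ (fun v => ‖latVec g v‖) hfin ⟨u, hu, hu1.le⟩
  refine ⟨v, hv, le_antisymm (not_lt.1 fun h => ?_) (gMin_le g hv)⟩
  obtain ⟨w, hw, hwv⟩ := (gMin_lt_iff_s9 g _).1 h
  exact absurd (hmin w ⟨hw, hwv.le.trans hv1⟩) (not_le.2 hwv)

lemma measurable_gMin : Measurable (gMin : SLR 2 → ℝ) := by
  refine measurable_of_Iio fun c => ?_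
  have : gMin ⁻¹' Set.Iio c
      = ⋃ v, {g : SLR 2 | latVec g v ≠ 0 ∧ ‖latVec g v‖ < c} := by
    ext g
    simp [gMin_lt_iff_s9]
  rw [this]
  refine MeasurableSet.iUnion fun v => ?_
  exact (measurable_latVec v (measurableSet_singleton 0).compl).inter
    ((measurable_latVec v).norm measurableSet_Iio)

/-- Two lattice vectors of norm less than `1` are parallel, by the integrality of the
determinant. -/
lemma latVec_parallel (g : SLR 2) {v w : Fin 2 → ℤ} (hv : ‖latVec g v‖ < 1)
    (hw : ‖latVec g w‖ < 1) :
    latVec g v 0 * latVec g w 1 = latVec g v 1 * latVec g w 0 := by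
  set x := latVec g v with hx
  set y := latVec g w with hy
  have hdet : x 0 * y 1 - x 1 * y 0 = ((v 0 * w 1 - v 1 * w 0 : ℤ) : ℝ) := by
    rw [hx, hy]
    push_cast
    simp only [latVec_zero, latVec_one]
    linear_combination ((v 0 : ℝ) * w 1 - v 1 * w 0) * SLR_det g
  have hlt : (x 0 * y 1 - x 1 * y 0) ^ 2 < 1 := by
    have h1 : (x 0 * y 1 - x 1 * y 0) ^ 2 ≤ ‖x‖ ^ 2 * ‖y‖ ^ 2 := by
      rw [norm_sq_eq_coords, norm_sq_eq_coords]
      nlinarith [sq_nonneg (x 0 * y 0 + x 1 * y 1)]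
    have h2 : ‖x‖ ^ 2 < 1 := by nlinarith [norm_nonneg x]
    have h3 : ‖y‖ ^ 2 < 1 := by nlinarith [norm_nonneg y]
    nlinarith [sq_nonneg ‖x‖, sq_nonneg ‖y‖]
  rw [hdet] at hlt
  have hzero : v 0 * w 1 - v 1 * w 0 = 0 := by
    rw [sq_lt_one_iff_abs_lt_one, ← Int.cast_abs] at hlt
    exact Int.abs_lt_one_iff.1 (Int.cast_lt.1 (hlt.trans_eq Int.cast_one.symm))
  rw [hzero] at hdet
  simpa [sub_eq_zero] using hdet

end MinimalNorm

section Angle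

lemma coord_one_ne_zero {x : EuclideanSpace ℝ (Fin 2)} (hx : x ≠ 0) (h0 : x 0 = 0) :
    x 1 ≠ 0 := fun h1 => hx (by ext i; fin_cases i <;> simp [h0, h1])

lemma lineAngle_eq_of_parallel {x y : EuclideanSpace ℝ (Fin 2)} (hx : x ≠ 0) (hy : y ≠ 0)
    (h : x 0 * y 1 = x 1 * y 0) : lineAngle x = lineAngle y := by
  by_cases hx0 : x 0 = 0
  · have hy0 : y 0 = 0 := by simpa [hx0, coord_one_ne_zero hx hx0] using h
    simp [lineAngle, hx0, hy0]
  · have hy0 : y 0 ≠ 0 := fun hy0 => by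
      simp [hy0, hx0, coord_one_ne_zero hy hy0] at h
    have : x 1 / x 0 = y 1 / y 0 := by
      rw [div_eq_div_iff hx0 hy0]
      linear_combination -h
    simp [lineAngle, hx0, hy0, this]

lemma neg_pi_div_two_lt_lineAngle (x : EuclideanSpace ℝ (Fin 2)) :
    -(Real.pi / 2) < lineAngle x := by
  unfold lineAngle
  split_ifs
  · linarith [Real.pi_pos]
  · exact Real.neg_pi_div_two_lt_arctan _

lemma lineAngle_le_pi_div_two (x : EuclideanSpace ℝ (Fin 2)) :
    lineAngle x ≤ Real.pi / 2 := by
  unfold lineAngle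
  split_ifs
  · exact le_rfl
  · exact (Real.arctan_lt_pi_div_two _).le

lemma norm_sq_mul_exp_lineAngle (x : EuclideanSpace ℝ (Fin 2)) :
    ((‖x‖ ^ 2 : ℝ) : ℂ) * Circle.exp (2 * lineAngle x) = (x 0 + x 1 * Complex.I) ^ 2 := by
  by_cases h0 : x 0 = 0
  · have : (2 : ℂ) * (Real.pi / 2) = Real.pi := by ring
    rw [norm_sq_eq_coords]
    simp [lineAngle, h0, Circle.coe_exp, this, mul_pow]
  · rw [norm_sq_eq_coords]
    set θ := lineAngle x with hθ
    have hθ' : θ = Real.arctan (x 1 / x 0) := by simp [hθ, lineAngle, h0]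
    have hcos : Real.cos θ ≠ 0 := by
      rw [hθ']; exact (Real.cos_arctan_pos _).ne'
    have hsin : x 0 * Real.sin θ = x 1 * Real.cos θ := by
      have := Real.tan_arctan (x 1 / x 0)
      rw [← hθ', Real.tan_eq_sin_div_cos, div_eq_div_iff hcos h0] at this
      linear_combination this
    have hsc := Real.sin_sq_add_cos_sq θ
    have hre : (x 0 ^ 2 + x 1 ^ 2) * Real.cos (2 * θ) = x 0 ^ 2 - x 1 ^ 2 := by
      rw [Real.cos_two_mul]
      linear_combination (-2 * (x 0 * Real.sin θ + x 1 * Real.cos θ)) * hsin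
        + (2 * x 0 ^ 2) * hsc
    have him : (x 0 ^ 2 + x 1 ^ 2) * Real.sin (2 * θ) = 2 * x 0 * x 1 := by
      rw [Real.sin_two_mul]
      linear_combination (2 * x 0 * Real.cos θ - 2 * x 1 * Real.sin θ) * hsin
        + (2 * x 0 * x 1) * hsc
    rw [Circle.coe_exp, Complex.exp_mul_I, ← Complex.ofReal_cos, ← Complex.ofReal_sin]
    have hre' := congrArg (fun y : ℝ => (y : ℂ)) hre
    have him' := congrArg (fun y : ℝ => (y : ℂ)) him
    simp only [Complex.ofReal_mul, Complex.ofReal_add, Complex.ofReal_sub,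
      Complex.ofReal_pow, Complex.ofReal_ofNat] at hre' him' ⊢
    linear_combination hre' + Complex.I * him' - (x 1 : ℂ) ^ 2 * Complex.I_sq

end Angle

section Rotation

/-- The rotation of the plane by the angle `t`. -/
def rotationMatrix (t : ℝ) : SLR 2 :=
  ⟨!![Real.cos t, -Real.sin t; Real.sin t, Real.cos t], by
    rw [Matrix.det_fin_two_of]
    linear_combination Real.sin_sq_add_cos_sq t⟩

lemma latVec_mul (h g : SLR 2) (v : Fin 2 → ℤ) (i : Fin 2) :
    latVec (h * g) v i = h.1 i 0 * latVec g v 0 + h.1 i 1 * latVec g v 1 := by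
  fin_cases i <;>
  · simp [latVec_zero, latVec_one, Matrix.mul_apply, Fin.sum_univ_two]
    ring

lemma latVec_rotation_zero (t : ℝ) (g : SLR 2) (v : Fin 2 → ℤ) :
    latVec (rotationMatrix t * g) v 0 = Real.cos t * latVec g v 0 - Real.sin t * latVec g v 1 := by
  rw [latVec_mul]
  simp [rotationMatrix]
  ring

lemma latVec_rotation_one (t : ℝ) (g : SLR 2) (v : Fin 2 → ℤ) :
    latVec (rotationMatrix t * g) v 1 = Real.sin t * latVec g v 0 + Real.cos t * latVec g v 1 := by
  rw [latVec_mul]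
  simp [rotationMatrix]

lemma norm_latVec_rotation (t : ℝ) (g : SLR 2) (v : Fin 2 → ℤ) :
    ‖latVec (rotationMatrix t * g) v‖ = ‖latVec g v‖ := by
  rw [← sq_eq_sq₀ (norm_nonneg _) (norm_nonneg _), norm_sq_eq_coords, norm_sq_eq_coords,
    latVec_rotation_zero, latVec_rotation_one]
  linear_combination (latVec g v 0 ^ 2 + latVec g v 1 ^ 2) * Real.sin_sq_add_cos_sq t

lemma latVec_rotation_ne_zero_iff (t : ℝ) (g : SLR 2) (v : Fin 2 → ℤ) :
    latVec (rotationMatrix t * g) v ≠ 0 ↔ latVec g v ≠ 0 := by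
  rw [← norm_ne_zero_iff, norm_latVec_rotation, norm_ne_zero_iff]

lemma gMin_rotation (t : ℝ) (g : SLR 2) : gMin (rotationMatrix t * g) = gMin g := by
  simp only [gMin, latVec_rotation_ne_zero_iff, norm_latVec_rotation]

lemma exp_lineAngle_rotation (t : ℝ) (g : SLR 2) {v : Fin 2 → ℤ} (hv : latVec g v ≠ 0) :
    Circle.exp (2 * lineAngle (latVec (rotationMatrix t * g) v))
      = Circle.exp (2 * t) * Circle.exp (2 * lineAngle (latVec g v)) := by
  have hnorm : ((‖latVec g v‖ ^ 2 : ℝ) : ℂ) ≠ 0 :=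
    Complex.ofReal_ne_zero.2 (pow_ne_zero 2 (norm_ne_zero_iff.2 hv))
  have h1 := norm_sq_mul_exp_lineAngle (latVec g v)
  have h2 := norm_sq_mul_exp_lineAngle (latVec (rotationMatrix t * g) v)
  rw [norm_latVec_rotation, latVec_rotation_zero, latVec_rotation_one] at h2
  have h3 : (Circle.exp (2 * t) : ℂ) = (Real.cos t + Real.sin t * Complex.I) ^ 2 := by
    rw [Circle.coe_exp, Complex.ofReal_cos, Complex.ofReal_sin, ← Complex.exp_mul_I,
      ← Complex.exp_nat_mul]
    push_cast
    ring_nf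
  ext
  refine mul_left_cancel₀ hnorm ?_
  rw [h2, Circle.coe_mul, mul_left_comm, h1, h3, ← mul_pow]
  congr 1
  push_cast
  linear_combination -(Complex.sin t * latVec g v 1) * Complex.I_sq

end Rotation

section Quotient

lemma exists_latVec_eq_of_mk_eq {g h : SLR 2}
    (hgh : (QuotientGroup.mk g : LatticeSpace 2) = QuotientGroup.mk h) (v : Fin 2 → ℤ) :
    ∃ w, latVec g w = latVec h v := by
  obtain ⟨γ, hγ⟩ := QuotientGroup.eq.1 hgh
  refine ⟨γ.1.mulVec v, ?_⟩
  have hh : h = g * Matrix.SpecialLinearGroup.map (Int.castRingHom ℝ) γ := by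
    rw [hγ, mul_inv_cancel_left]
  ext i
  rw [hh]
  fin_cases i <;>
  · simp [latVec_zero, latVec_one, Matrix.mul_apply, Fin.sum_univ_two]
    ring

lemma gMin_eq_of_mk_eq {g h : SLR 2}
    (hgh : (QuotientGroup.mk g : LatticeSpace 2) = QuotientGroup.mk h) : gMin g = gMin h := by
  have aux {g h : SLR 2}
      (hgh : (QuotientGroup.mk g : LatticeSpace 2) = QuotientGroup.mk h) :
      gMin g ≤ gMin h := by
    refine le_of_forall_gt fun c hc => ?_
    obtain ⟨v, hv⟩ := (gMin_lt_iff_s9 h c).1 hc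
    obtain ⟨w, hw⟩ := exists_latVec_eq_of_mk_eq hgh v
    exact (gMin_lt_iff_s9 g c).2 ⟨w, hw ▸ hv⟩
  exact (aux hgh).antisymm (aux hgh.symm)

/-- The minimal norm of a lattice. -/
def latMin (L : LatticeSpace 2) : ℝ := gMin (Quotient.out L)

lemma mk_out (L : LatticeSpace 2) : (QuotientGroup.mk (Quotient.out L) : LatticeSpace 2) = L :=
  Quotient.out_eq L

lemma latMin_mk (g : SLR 2) : latMin (QuotientGroup.mk g) = gMin g :=
  gMin_eq_of_mk_eq (mk_out _)

/-- The angle of the line spanned by a shortest nonzero vector of a lattice of minimal norm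
less than `1`, and `0` for all other lattices. -/
def latAngle (L : LatticeSpace 2) : ℝ :=
  if latMin L < 1 then
    lineAngle (latVec (Quotient.out L) (exists_norm_latVec_eq_gMin (Quotient.out L)).choose)
  else 0

lemma latAngle_mk (g : SLR 2) {v : Fin 2 → ℤ} (hv : latVec g v ≠ 0) (hv1 : ‖latVec g v‖ < 1) :
    latAngle (QuotientGroup.mk g) = lineAngle (latVec g v) := by
  have hlt : gMin g < 1 := (gMin_le g hv).trans_lt hv1
  set L : LatticeSpace 2 := QuotientGroup.mk g with hL
  rw [latAngle, if_pos (by rwa [hL, latMin_mk])]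
  have hmin := exists_norm_latVec_eq_gMin (Quotient.out L)
  obtain ⟨hu, hu1⟩ := hmin.choose_spec
  have hmk : (QuotientGroup.mk g : LatticeSpace 2) = QuotientGroup.mk (Quotient.out L) :=
    (mk_out L).symm
  obtain ⟨w, hw⟩ := exists_latVec_eq_of_mk_eq hmk hmin.choose
  replace hu1 : ‖latVec (Quotient.out L) hmin.choose‖ < 1 := by
    rwa [hu1, ← gMin_eq_of_mk_eq hmk]
  rw [← hw] at hu hu1 ⊢
  exact lineAngle_eq_of_parallel hu hv (latVec_parallel g hu1 hv1)

lemma measurable_latAngle : Measurable latAngle := by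
  rw [QuotientGroup.measurable_from_quotient]
  intro A hA
  have : latAngle ∘ QuotientGroup.mk ⁻¹' A
      = (⋃ v, {g : SLR 2 | (latVec g v ≠ 0 ∧ ‖latVec g v‖ < 1) ∧ lineAngle (latVec g v) ∈ A})
        ∪ {g : SLR 2 | ¬ gMin g < 1 ∧ (0 : ℝ) ∈ A} := by
    ext g
    simp only [Set.mem_preimage, Function.comp_apply, Set.mem_union, Set.mem_iUnion,
      Set.mem_ofPred_eq]
    by_cases hg : gMin g < 1
    · obtain ⟨v, hv, hv1⟩ := (gMin_lt_iff_s9 g 1).1 hg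
      constructor
      · exact fun h => Or.inl ⟨v, ⟨hv, hv1⟩, latAngle_mk g hv hv1 ▸ h⟩
      · rintro (⟨w, ⟨hw, hw1⟩, h⟩ | ⟨h, -⟩)
        · exact latAngle_mk g hw hw1 ▸ h
        · exact absurd hg h
    · rw [latAngle, latMin_mk, if_neg hg]
      refine ⟨fun h => Or.inr ⟨hg, h⟩, ?_⟩
      rintro (⟨v, hv, -⟩ | h)
      · exact absurd ((gMin_lt_iff_s9 g 1).2 ⟨v, hv⟩) hg
      · exact h.2
  rw [this]
  refine (MeasurableSet.iUnion fun v => ?_).union ?_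
  · exact ((measurable_latVec v (measurableSet_singleton 0).compl).inter
      ((measurable_latVec v).norm measurableSet_Iio)).inter
      ((measurable_lineAngle.comp (measurable_latVec v)) hA)
  · exact (measurable_gMin measurableSet_Iio).compl.inter (MeasurableSet.const _)

lemma latMin_rotation (t : ℝ) (L : LatticeSpace 2) : latMin (rotationMatrix t • L) = latMin L := by
  induction L using QuotientGroup.induction_on with
  | H g =>
    change latMin (QuotientGroup.mk (rotationMatrix t * g)) = _
    rw [latMin_mk, latMin_mk, gMin_rotation]

/-- The direction, modulo sign, of the shortest nonzero vectors of a lattice, encoded as a point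
of the circle by doubling the angle. -/
def latDir (L : LatticeSpace 2) : Circle := Circle.exp (2 * latAngle L)

lemma measurable_latDir : Measurable latDir :=
  Circle.exp.continuous.measurable.comp (measurable_latAngle.const_mul 2)

lemma latDir_rotation (t : ℝ) {L : LatticeSpace 2} (hL : latMin L < 1) :
    latDir (rotationMatrix t • L) = Circle.exp (2 * t) * latDir L := by
  induction L using QuotientGroup.induction_on with
  | H g =>
    rw [latMin_mk, gMin_lt_iff_s9] at hL
    obtain ⟨v, hv, hv1⟩ := hL
    change latDir (QuotientGroup.mk (rotationMatrix t * g)) = _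
    rw [latDir, latDir, latAngle_mk g hv hv1,
      latAngle_mk (rotationMatrix t * g) ((latVec_rotation_ne_zero_iff t g v).2 hv)
        (by rwa [norm_latVec_rotation]), exp_lineAngle_rotation t g hv]

lemma arg_latDir_div_two (L : LatticeSpace 2) : (latDir L : ℂ).arg / 2 = latAngle L := by
  have h : -(Real.pi / 2) < latAngle L ∧ latAngle L ≤ Real.pi / 2 := by
    unfold latAngle
    split_ifs
    · exact ⟨neg_pi_div_two_lt_lineAngle _, lineAngle_le_pi_div_two _⟩
    · constructor <;> linarith [Real.pi_pos]
  rw [latDir, Circle.arg_exp (by linarith) (by linarith)]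
  ring

lemma measurable_circle_arg_div_two : Measurable fun z : Circle => (z : ℂ).arg / 2 :=
  (Complex.measurable_arg.comp (show Continuous fun z : Circle => (z : ℂ) by fun_prop).measurable).div_const 2

lemma isMulLeftInvariant_map_latDir (μ : Measure (LatticeSpace 2))
    (hinv : ∀ (g : SLR 2) (s : Set (LatticeSpace 2)), μ ((g • ·) ⁻¹' s) = μ s)
    {R : Set ℝ} (hR1 : R ⊆ Set.Iio 1) :
    ((μ.restrict (latMin ⁻¹' R)).map latDir).IsMulLeftInvariant := by
  refine ⟨fun w => ?_⟩
  ext A hA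
  have hw : Measurable fun z : Circle => w * z := (continuous_const_mul w).measurable
  rw [Measure.map_apply hw hA, Measure.map_apply measurable_latDir (hw hA),
    Measure.map_apply measurable_latDir hA,
    Measure.restrict_apply (measurable_latDir (hw hA)),
    Measure.restrict_apply (measurable_latDir hA),
    ← hinv (rotationMatrix ((w : ℂ).arg / 2)) (latDir ⁻¹' A ∩ _)]
  congr 1
  ext L
  simp only [Set.mem_inter_iff, Set.mem_preimage, latMin_rotation]
  refine and_congr_left fun hL => ?_
  rw [latDir_rotation _ (hR1 hL), mul_div_cancel₀ _ two_ne_zero, Circle.exp_arg]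

lemma mk_image_gMin_mem (R : Set ℝ) :
    (QuotientGroup.mk '' {g : SLR 2 | gMin g ∈ R} : Set (LatticeSpace 2)) = latMin ⁻¹' R := by
  ext L
  constructor
  · rintro ⟨g, hg, rfl⟩
    rwa [Set.mem_preimage, latMin_mk]
  · exact fun hL => ⟨Quotient.out L, hL, mk_out L⟩

lemma mk_image_lineAngle_mem (A : Set ℝ) {R : Set ℝ} (hR1 : R ⊆ Set.Iio 1) :
    (QuotientGroup.mk '' {g : SLR 2 |
        (∃ v : Fin 2 → ℤ, latVec g v ≠ 0 ∧ ‖latVec g v‖ = gMin g ∧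
          lineAngle (latVec g v) ∈ A) ∧ gMin g ∈ R} : Set (LatticeSpace 2))
      = latDir ⁻¹' {z | (z : ℂ).arg / 2 ∈ A} ∩ latMin ⁻¹' R := by
  ext L
  simp only [Set.mem_inter_iff, Set.mem_preimage, Set.mem_ofPred_eq, arg_latDir_div_two]
  constructor
  · rintro ⟨g, ⟨⟨v, hv, hvmin, hA⟩, hR⟩, rfl⟩
    rw [latMin_mk, latAngle_mk g hv (hvmin.trans_lt (hR1 hR))]
    exact ⟨hA, hR⟩
  · rintro ⟨hA, hR⟩
    obtain ⟨g, rfl⟩ := QuotientGroup.mk_surjective L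
    rw [latMin_mk] at hR
    obtain ⟨v, hv, hvmin⟩ := exists_norm_latVec_eq_gMin g
    rw [latAngle_mk g hv (hvmin.trans_lt (hR1 hR))] at hA
    exact ⟨g, ⟨⟨v, hv, hvmin, hA⟩, hR⟩, rfl⟩

end Quotient

/-- Conditionally on `{‖L‖ < 1}`, the angle `α(L)` of the line spanned by a shortest
nonzero vector of `L` and the minimal norm `‖L‖` are independent under the normalized
Haar probability measure `μ₂` on `𝒮₂` (formalized as: any `SL₂(ℝ)`-invariant Borel
probability measure). -/
theorem stmt9 (μ : Measure (LatticeSpace 2)) [IsProbabilityMeasure μ]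
    (hinv : ∀ (g : SLR 2) (s : Set (LatticeSpace 2)), μ ((g • ·) ⁻¹' s) = μ s)
    (a b : ℝ) (ha : -(Real.pi / 2) ≤ a) (hab : a ≤ b) (hb : b ≤ Real.pi / 2)
    (r₁ r₂ : ℝ) (hr₁ : 0 < r₁) (hr₁₂ : r₁ ≤ r₂) (hr₂ : r₂ < 1) :
    μ (QuotientGroup.mk '' {g : SLR 2 |
          (∃ v : Fin 2 → ℤ, latVec g v ≠ 0 ∧ ‖latVec g v‖ = gMin g ∧
            lineAngle (latVec g v) ∈ Set.Icc a b) ∧ gMin g ∈ Set.Icc r₁ r₂}) *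
        μ (QuotientGroup.mk '' {g : SLR 2 | gMin g < 1})
      = μ (QuotientGroup.mk '' {g : SLR 2 |
            (∃ v : Fin 2 → ℤ, latVec g v ≠ 0 ∧ ‖latVec g v‖ = gMin g ∧
              lineAngle (latVec g v) ∈ Set.Icc a b) ∧ gMin g < 1}) *
          μ (QuotientGroup.mk '' {g : SLR 2 | gMin g ∈ Set.Icc r₁ r₂}) := by
  have key (R S : Set ℝ) (hR1 : R ⊆ Set.Iio 1)
      (hS1 : S ⊆ Set.Iio 1) (A : Set Circle) (hA : MeasurableSet A) :
      μ (latDir ⁻¹' A ∩ latMin ⁻¹' R) * μ (latMin ⁻¹' S)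
        = μ (latDir ⁻¹' A ∩ latMin ⁻¹' S) * μ (latMin ⁻¹' R) := by
    have := isMulLeftInvariant_map_latDir μ hinv hR1
    have := isMulLeftInvariant_map_latDir μ hinv hS1
    have h := mul_measure_univ_comm_of_isMulLeftInvariant
      ((μ.restrict (latMin ⁻¹' R)).map latDir) ((μ.restrict (latMin ⁻¹' S)).map latDir) A
    simpa only [Measure.map_apply measurable_latDir hA,
      Measure.map_apply measurable_latDir MeasurableSet.univ, Set.preimage_univ,
      Measure.restrict_apply (measurable_latDir hA), Measure.restrict_apply_univ] using h
  have hIcc : Set.Icc r₁ r₂ ⊆ Set.Iio 1 := fun r hr => hr.2.trans_lt hr₂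
  have h := key (Set.Icc r₁ r₂) (Set.Iio 1) hIcc subset_rfl
    {z | (z : ℂ).arg / 2 ∈ Set.Icc a b}
    (measurable_circle_arg_div_two measurableSet_Icc)
  rw [← mk_image_lineAngle_mem _ hIcc, ← mk_image_lineAngle_mem _ subset_rfl,
    ← mk_image_gMin_mem, ← mk_image_gMin_mem] at h
  exact h
end
end
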